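/- arXiv:2110.08337 — 5 statements merged into one kernel-verified Lean document; each statement's English description precedes it below -/
import Mathlib

section
/- Let B ⊆ ℝ² be an open set and let F₁, F₂ : B → ℝ be C^∞ functions that are nowhere zero on B (the coefficient functions of the Pfaffian form δξ = F₁ dx₁ + F₂ dx₂). Then δξ is locally integrable on B: for every point p ∈ B there exist an open neighborhood A ⊆ B of p and functions μ, ψ : A → ℝ, with μ nowhere zero on A and ψ of class C^∞, such that F₁ = μ · ∂ψ/∂x₁ and F₂ = μ · ∂ψ/∂x₂ on A. -/
open Set

/-- Partial derivative of `f : ℝⁿ → ℝ` in the `i`-th coordinate direction. -/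
noncomputable def pd {n : ℕ} (f : (Fin n → ℝ) → ℝ) (i : Fin n) (x : Fin n → ℝ) : ℝ :=
  fderiv ℝ f x (Pi.single i 1)

open Filter Topology MeasureTheory

theorem hasFDerivAt_of_hasDerivAt_partials {H a b : ℝ × ℝ → ℝ}
    (ha : Continuous a) (hb : Continuous b)
    (hHa : ∀ t c, HasDerivAt (fun s => H (s, c)) (a (t, c)) t)
    (hHb : ∀ t c, HasDerivAt (fun s => H (t, s)) (b (t, c)) c) (p : ℝ × ℝ) :
    HasFDerivAt H
      (a p • ContinuousLinearMap.fst ℝ ℝ ℝ + b p • ContinuousLinearMap.snd ℝ ℝ ℝ) p := by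
  have key := hasStrictFDerivAt_uncurry_coprod (𝕜 := ℝ) (u := p) (f := fun s c => H (s, c))
    (f₁ := fun s c => ContinuousLinearMap.toSpanSingleton ℝ (a (s, c)))
    (f₂ := fun s c => ContinuousLinearMap.toSpanSingleton ℝ (b (s, c)))
    (Eventually.of_forall fun v => (hHa v.1 v.2).hasFDerivAt)
    (Eventually.of_forall fun v => (hHb v.1 v.2).hasFDerivAt)
    ((ContinuousLinearMap.toSpanSingletonCLE (𝕜 := ℝ) (E := ℝ)).continuous.comp ha).continuousAt
    ((ContinuousLinearMap.toSpanSingletonCLE (𝕜 := ℝ) (E := ℝ)).continuous.comp hb).continuousAt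
  refine key.hasFDerivAt.congr_fderiv ?_
  ext <;> simp [Function.HasUncurry.uncurry]

theorem contDiff_succ_of_hasDerivAt_partials {n : ℕ} {H a b : ℝ × ℝ → ℝ}
    (ha : ContDiff ℝ n a) (hb : ContDiff ℝ n b)
    (hHa : ∀ t c, HasDerivAt (fun s => H (s, c)) (a (t, c)) t)
    (hHb : ∀ t c, HasDerivAt (fun s => H (t, s)) (b (t, c)) c) :
    ContDiff ℝ (n + 1) H :=
  contDiff_succ_iff_hasFDerivAt.2 ⟨_, (ha.smul contDiff_const).add (hb.smul contDiff_const),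
    hasFDerivAt_of_hasDerivAt_partials ha.continuous hb.continuous hHa hHb⟩

theorem hasDerivAt_snd_of_contDiff {n : WithTop ℕ∞} (hn : n ≠ 0) {h : ℝ × ℝ → ℝ}
    (hh : ContDiff ℝ n h) (t c : ℝ) :
    HasDerivAt (fun s => h (t, s)) (fderiv ℝ h (t, c) (0, 1)) c :=
  ((hh.differentiable hn).differentiableAt.hasFDerivAt (x := (t, c))).comp_hasDerivAt c
    ((hasDerivAt_const c t).prodMk (hasDerivAt_id c))

theorem contDiff_fderiv_snd {n m : WithTop ℕ∞} (hmn : m + 1 ≤ n) {h : ℝ × ℝ → ℝ}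
    (hh : ContDiff ℝ n h) : ContDiff ℝ m fun p => fderiv ℝ h p (0, 1) :=
  (hh.fderiv_right hmn).clm_apply contDiff_const

theorem contDiff_parametric_primitive (t₀ : ℝ) {n : ℕ} {h : ℝ × ℝ → ℝ} (hh : ContDiff ℝ n h) :
    ContDiff ℝ n fun p : ℝ × ℝ => ∫ s in t₀..p.1, h (s, p.2) := by
  induction n generalizing h with
  | zero =>
    have hc := hh.continuous
    refine contDiff_zero.2 ?_
    exact intervalIntegral.continuous_parametric_intervalIntegral_of_continuous
      (f := fun (p : ℝ × ℝ) s => h (s, p.2)) (by fun_prop) continuous_fst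
  | succ n ih =>
    have hc := hh.continuous
    have hd : ContDiff ℝ n fun p => fderiv ℝ h p (0, 1) :=
      contDiff_fderiv_snd (by push_cast; rfl) hh
    have hdc := hd.continuous
    refine contDiff_succ_of_hasDerivAt_partials (hh.of_le (by norm_cast; omega)) (ih hd)
      (fun t c => ?_) fun t c => ?_
    · have : Continuous fun s => h (s, c) := by fun_prop
      exact this.integral_hasStrictDerivAt t₀ t |>.hasDerivAt
    · obtain ⟨M, hM⟩ := (isCompact_uIcc (a := t₀) (b := t)).prod (isCompact_closedBall c 1)
        |>.exists_bound_of_continuousOn hdc.continuousOn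
      refine (intervalIntegral.hasDerivAt_integral_of_dominated_loc_of_deriv_le
        (F := fun c s => h (s, c)) (F' := fun c s => fderiv ℝ h (s, c) (0, 1))
        (bound := fun _ => M) (Metric.closedBall_mem_nhds c one_pos)
        (Eventually.of_forall fun x => ?_) ?_ ?_ ?_ (by simp) ?_).2
      · exact (show Continuous fun s => h (s, x) by fun_prop).aestronglyMeasurable
      · exact (show Continuous fun s => h (s, c) by fun_prop).intervalIntegrable _ _
      · exact (show Continuous fun s => fderiv ℝ h (s, c) (0, 1) by
          exact hdc.comp (by fun_prop)).aestronglyMeasurable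
      · exact ae_of_all _ fun s hs x hx => hM (s, x) ⟨uIoc_subset_uIcc hs, hx⟩
      · exact ae_of_all _ fun s _ x _ =>
          hasDerivAt_snd_of_contDiff (by simp) hh s x

/-- The averaged slope of `f (s, ·)` between `v.2.2` and `v.2.1`, where `s = v.1`. -/
noncomputable def avgSlope (f : ℝ × ℝ → ℝ) (v : ℝ × ℝ × ℝ) : ℝ :=
  ∫ u in (0 : ℝ)..1, fderiv ℝ f (v.1, v.2.2 + u * (v.2.1 - v.2.2)) (0, 1)

theorem continuous_avgSlope {f : ℝ × ℝ → ℝ} (hf : ContDiff ℝ 1 f) : Continuous (avgSlope f) := by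
  have hd : Continuous fun p => fderiv ℝ f p (0, 1) :=
    (contDiff_fderiv_snd (m := 0) (by simp) hf).continuous
  exact intervalIntegral.continuous_parametric_intervalIntegral_of_continuous'
    (f := fun (v : ℝ × ℝ × ℝ) u => fderiv ℝ f (v.1, v.2.2 + u * (v.2.1 - v.2.2)) (0, 1))
    (hd.comp (by fun_prop)) 0 1

theorem avgSlope_self (f : ℝ × ℝ → ℝ) (s y : ℝ) :
    avgSlope f (s, y, y) = fderiv ℝ f (s, y) (0, 1) := by
  simp [avgSlope]

theorem avgSlope_mul_sub {f : ℝ × ℝ → ℝ} (hf : ContDiff ℝ 1 f) (s y z : ℝ) :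
    avgSlope f (s, y, z) * (y - z) = f (s, y) - f (s, z) := by
  have hd : Continuous fun p => fderiv ℝ f p (0, 1) :=
    (contDiff_fderiv_snd (m := 0) (by simp) hf).continuous
  have h := intervalIntegral.integral_eq_sub_of_hasDerivAt (a := 0) (b := 1)
    (f := fun u => f (s, z + u * (y - z)))
    (f' := fun u => fderiv ℝ f (s, z + u * (y - z)) (0, 1) * (y - z))
    (fun u _ => (hasDerivAt_snd_of_contDiff one_ne_zero hf s _).comp u
      (by simpa using ((hasDerivAt_id u).mul_const (y - z)).const_add z))
    (((hd.comp (g := fun p => fderiv ℝ f p (0, 1)) (f := fun u : ℝ => (s, z + u * (y - z)))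
      (by fun_prop)).mul continuous_const).intervalIntegrable 0 1)
  rw [intervalIntegral.integral_mul_const] at h
  simpa [avgSlope] using h

theorem abs_avgSlope_le {f : ℝ × ℝ → ℝ} {K : ℝ} (hK : ∀ p, |fderiv ℝ f p (0, 1)| ≤ K)
    (v : ℝ × ℝ × ℝ) : |avgSlope f v| ≤ K := by
  simpa [avgSlope] using intervalIntegral.norm_integral_le_of_norm_le_const (a := 0) (b := 1)
    fun u _ => (Real.norm_eq_abs _).trans_le (hK (v.1, v.2.2 + u * (v.2.1 - v.2.2)))

theorem sub_eq_mul_exp_integral_avgSlope {f : ℝ × ℝ → ℝ} (hf : ContDiff ℝ 1 f) (t₀ : ℝ)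
    {y z : ℝ → ℝ} (hy : ∀ t, HasDerivAt y (f (t, y t)) t) (hz : ∀ t, HasDerivAt z (f (t, z t)) t)
    (t : ℝ) :
    y t - z t = (y t₀ - z t₀) * Real.exp (∫ s in t₀..t, avgSlope f (s, y s, z s)) := by
  have hyc : Continuous y := continuous_iff_continuousAt.2 fun t => (hy t).continuousAt
  have hzc : Continuous z := continuous_iff_continuousAt.2 fun t => (hz t).continuousAt
  have hG : Continuous fun s => avgSlope f (s, y s, z s) :=
    (continuous_avgSlope hf).comp (by fun_prop)
  set I : ℝ → ℝ := fun t => ∫ s in t₀..t, avgSlope f (s, y s, z s) with hI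
  have hId (t : ℝ) : HasDerivAt I (avgSlope f (t, y t, z t)) t :=
    (hG.integral_hasStrictDerivAt t₀ t).hasDerivAt
  have hconst (t : ℝ) : HasDerivAt (fun t => (y t - z t) * Real.exp (-I t)) 0 t := by
    refine (((hy t).sub (hz t)).mul (hId t).neg.exp).congr_deriv ?_
    simp only [Pi.sub_apply, ← avgSlope_mul_sub hf]
    ring
  have h := is_const_of_deriv_eq_zero (fun t => (hconst t).differentiableAt)
    (fun t => (hconst t).deriv) t t₀
  simp only [hI, intervalIntegral.integral_same, neg_zero, Real.exp_zero, mul_one] at h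
  rw [← h, mul_assoc, ← Real.exp_add]
  simp

theorem exists_global_solution {f : ℝ × ℝ → ℝ} (hf : ContDiff ℝ 1 f) (hc : HasCompactSupport f)
    (t₀ c : ℝ) : ∃ y : ℝ → ℝ, y t₀ = c ∧ ∀ t, HasDerivAt y (f (t, y t)) t := by
  obtain ⟨K, hK⟩ := hf.lipschitzWith_of_hasCompactSupport hc one_ne_zero
  obtain ⟨L, hL⟩ := hc.exists_bound_of_continuous hf.continuous
  obtain ⟨R, hR0, hR⟩ := hc.isCompact.isBounded.subset_closedBall_lt 0 ((t₀, c) : ℝ × ℝ)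
  have hL0 : 0 ≤ L := (norm_nonneg _).trans (hL (t₀, c))
  have hle : t₀ - R ≤ t₀ + R := by linarith
  have hpl : IsPicardLindelof (fun t x => f (t, x)) (tmin := t₀ - R) (tmax := t₀ + R)
      ⟨t₀, by constructor <;> linarith⟩ c ⟨L * R, by positivity⟩ 0 ⟨L, hL0⟩ K := by
    refine ⟨fun t _ => LipschitzWith.lipschitzOnWith ?_, fun x _ => ?_, fun t _ x _ => hL _, ?_⟩
    · simpa [Function.comp_def] using hK.comp (LipschitzWith.prodMk_left t)
    · exact (hf.continuous.comp (by fun_prop)).continuousOn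
    · simp only [add_sub_cancel_left, sub_sub_cancel, max_self, NNReal.coe_zero, sub_zero]
      exact le_rfl
  obtain ⟨α, hα, hα'⟩ := hpl.exists_eq_forall_mem_Icc_hasDerivWithinAt₀
  have hαc : ContinuousOn α (Icc (t₀ - R) (t₀ + R)) := fun t ht => (hα' t ht).continuousWithinAt
  set β : ℝ → ℝ := IccExtend hle ((Icc (t₀ - R) (t₀ + R)).domRestrict α) with hβ
  have hβc : Continuous β := (continuousOn_iff_continuous_domRestrict.1 hαc).Icc_extend'
  have hβα : ∀ t ∈ Icc (t₀ - R) (t₀ + R), β t = α t := fun t ht => by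
    rw [hβ, IccExtend_of_mem _ _ ht, domRestrict_apply]
  have hg : Continuous fun s => f (s, β s) := hf.continuous.comp (by fun_prop)
  refine ⟨fun t => c + ∫ s in t₀..t, f (s, β s), by simp, fun t => ?_⟩
  refine ((hg.integral_hasStrictDerivAt t₀ t).hasDerivAt.const_add c).congr_deriv ?_
  by_cases ht : t ∈ Icc (t₀ - R) (t₀ + R)
  · have hsub : uIcc t₀ t ⊆ Icc (t₀ - R) (t₀ + R) :=
      uIcc_subset_Icc (by constructor <;> linarith) ht
    have : ∫ s in t₀..t, f (s, β s) = α t - α t₀ := by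
      refine intervalIntegral.integral_eq_sub_of_hasDeriv_right (hαc.mono hsub)
        (fun s hs => ?_) (hg.intervalIntegrable _ _)
      have hs' : s ∈ Ioo (t₀ - R) (t₀ + R) :=
        ⟨(le_min (by linarith) ht.1).trans_lt hs.1, hs.2.trans_le (max_le (by linarith) ht.2)⟩
      rw [hβα s (Ioo_subset_Icc_self hs')]
      exact ((hα' s (Ioo_subset_Icc_self hs')).hasDerivAt
        (Icc_mem_nhds hs'.1 hs'.2)).hasDerivWithinAt
    simp only [this, hβα t ht]
    simp only at hα
    rw [hα, add_sub_cancel]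
  · have hzero (x : ℝ) : f (t, x) = 0 := by
      by_contra hne
      have h := hR (subset_tsupport f hne)
      rw [← closedBall_prod_same, mem_prod, Real.closedBall_eq_Icc] at h
      exact ht h.1
    rw [hzero, hzero]

theorem exists_contDiff_flow {f : ℝ × ℝ → ℝ} (hf : ContDiff ℝ (⊤ : ℕ∞) f)
    (hc : HasCompactSupport f) (t₀ : ℝ) :
    ∃ φ E : ℝ × ℝ → ℝ, ContDiff ℝ (⊤ : ℕ∞) φ ∧ (∀ c, φ (t₀, c) = c) ∧ (∀ p, E p ≠ 0) ∧
      ∀ p, HasFDerivAt φ (f (p.1, φ p) • ContinuousLinearMap.fst ℝ ℝ ℝ +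
        E p • ContinuousLinearMap.snd ℝ ℝ ℝ) p := by
  have hf1 : ContDiff ℝ 1 f := hf.of_le (by norm_cast)
  choose y hy₀ hy using exists_global_solution hf1 hc t₀
  obtain ⟨L, hL⟩ := hc.exists_bound_of_continuous hf1.continuous
  have hd : ContDiff ℝ (⊤ : ℕ∞) fun p => fderiv ℝ f p (0, 1) :=
    contDiff_fderiv_snd (by simp) hf
  obtain ⟨K, hK⟩ := (hc.fderiv_apply (𝕜 := ℝ) (0, 1)).exists_bound_of_continuous hd.continuous
  have hyc (c : ℝ) : Continuous (y c) := continuous_iff_continuousAt.2 fun t =>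
    (hy c t).continuousAt
  have hdiff (c c' t : ℝ) : y c' t - y c t =
      (c' - c) * Real.exp (∫ s in t₀..t, avgSlope f (s, y c' s, y c s)) := by
    simpa [hy₀] using sub_eq_mul_exp_integral_avgSlope hf1 t₀ (hy c') (hy c) t
  have hcont_c (t : ℝ) : Continuous fun c => y c t := by
    refine (LipschitzWith.of_dist_le_mul (K := ⟨Real.exp (K * |t - t₀|), by positivity⟩)
      fun c' c => ?_).continuous
    rw [Real.dist_eq, Real.dist_eq, hdiff, abs_mul, Real.abs_exp, mul_comm]
    refine mul_le_mul_of_nonneg_right (Real.exp_le_exp.2 ((le_abs_self _).trans ?_))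
      (abs_nonneg _)
    exact intervalIntegral.norm_integral_le_of_norm_le_const fun s _ =>
      (Real.norm_eq_abs _).trans_le (abs_avgSlope_le hK _)
  set φ : ℝ × ℝ → ℝ := fun p => y p.2 p.1 with hφ
  have hφc : Continuous φ := by
    refine continuous_prod_of_continuous_lipschitzWith φ L.toNNReal (fun t => hcont_c t)
      fun c => lipschitzWith_of_nnnorm_deriv_le (fun t => (hy c t).differentiableAt) fun t => ?_
    rw [show deriv (fun t => φ (t, c)) t = f (t, y c t) from (hy c t).deriv,
      ← NNReal.coe_le_coe, coe_nnnorm]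
    exact (hL _).trans (Real.le_coe_toNNReal L)
  set E : ℝ × ℝ → ℝ := fun p => Real.exp (∫ s in t₀..p.1, fderiv ℝ f (s, φ (s, p.2)) (0, 1))
    with hE
  have hφt (t c : ℝ) : HasDerivAt (fun s => φ (s, c)) (f (t, φ (t, c))) t := hy c t
  have hφcd (t c : ℝ) : HasDerivAt (fun s => φ (t, s)) (E (t, c)) c := by
    have hcont : Continuous fun c' =>
        Real.exp (∫ s in t₀..t, avgSlope f (s, φ (s, c'), φ (s, c))) := by
      refine Real.continuous_exp.comp
        (intervalIntegral.continuous_parametric_intervalIntegral_of_continuous'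
          (f := fun c' s => avgSlope f (s, φ (s, c'), φ (s, c))) ?_ t₀ t)
      exact (continuous_avgSlope hf1).comp (by fun_prop)
    rw [hasDerivAt_iff_tendsto_slope]
    have h := hcont.tendsto c
    simp only [avgSlope_self] at h
    refine (h.mono_left nhdsWithin_le_nhds).congr' ?_
    filter_upwards [self_mem_nhdsWithin] with c' hc'
    have : c' - c ≠ 0 := sub_ne_zero.2 hc'
    rw [slope_def_field, hφ, hdiff]
    field_simp
  have hsmooth (n : ℕ) : ContDiff ℝ n φ := by
    induction n with
    | zero => exact contDiff_zero.2 hφc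
    | succ n ih =>
      refine contDiff_succ_of_hasDerivAt_partials (a := fun p => f (p.1, φ p)) (b := E)
        ((hf.of_le (by norm_cast; exact le_top)).comp (contDiff_fst.prodMk ih))
        (Real.contDiff_exp.comp (contDiff_parametric_primitive t₀
          (h := fun p => fderiv ℝ f (p.1, φ p) (0, 1)) ?_)) hφt hφcd
      exact (hd.of_le (by norm_cast; exact le_top)).comp (contDiff_fst.prodMk ih)
  refine ⟨φ, E, contDiff_infty.2 hsmooth, hy₀, fun p => (Real.exp_pos _).ne',
    hasFDerivAt_of_hasDerivAt_partials (a := fun p => f (p.1, φ p)) ?_ ?_ hφt hφcd⟩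
  · exact hf1.continuous.comp (by fun_prop)
  · exact Real.continuous_exp.comp (contDiff_zero.1 (contDiff_parametric_primitive t₀ (n := 0)
      (h := fun p => fderiv ℝ f (p.1, φ p) (0, 1))
      (contDiff_zero.2 (hd.continuous.comp (by fun_prop)))))

/-- The shear `(u, v) ↦ (u, a u + b v)` with `b ≠ 0`. -/
noncomputable def shearEquiv (a b : ℝ) (hb : b ≠ 0) : (ℝ × ℝ) ≃L[ℝ] ℝ × ℝ :=
  ContinuousLinearEquiv.equivOfInverse
    ((ContinuousLinearMap.fst ℝ ℝ ℝ).prod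
      (a • ContinuousLinearMap.fst ℝ ℝ ℝ + b • ContinuousLinearMap.snd ℝ ℝ ℝ))
    ((ContinuousLinearMap.fst ℝ ℝ ℝ).prod
      (b⁻¹ • (ContinuousLinearMap.snd ℝ ℝ ℝ - a • ContinuousLinearMap.fst ℝ ℝ ℝ)))
    (fun x => by ext <;> simp [hb]) (fun x => by ext <;> simp [hb])

/-- Near any point, the scalar equation `y' = f (t, y)` has a smooth first integral whose
derivative is a nonzero multiple of `dy - f dt`. -/
theorem exists_contDiffOn_firstIntegral {f : ℝ × ℝ → ℝ} (hf : ContDiff ℝ (⊤ : ℕ∞) f)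
    (hc : HasCompactSupport f) (p : ℝ × ℝ) :
    ∃ U : Set (ℝ × ℝ), IsOpen U ∧ p ∈ U ∧ ∃ ψ : ℝ × ℝ → ℝ, ContDiffOn ℝ (⊤ : ℕ∞) ψ U ∧
      ∀ z ∈ U, ∃ e : ℝ, e ≠ 0 ∧ HasFDerivAt ψ
        (e • (ContinuousLinearMap.snd ℝ ℝ ℝ - f z • ContinuousLinearMap.fst ℝ ℝ ℝ)) z := by
  obtain ⟨φ, E, hφ, hφ₀, hE, hφd⟩ := exists_contDiff_flow hf hc p.1
  set Φ : ℝ × ℝ → ℝ × ℝ := fun q => (q.1, φ q) with hΦ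
  have hΦs : ContDiff ℝ (⊤ : ℕ∞) Φ := contDiff_fst.prodMk hφ
  have hΦd (q : ℝ × ℝ) :
      HasFDerivAt Φ (shearEquiv (f (Φ q)) (E q) (hE q) : ℝ × ℝ →L[ℝ] ℝ × ℝ) q :=
    hasFDerivAt_fst.prodMk (hφd q)
  have hne : ((⊤ : ℕ∞) : WithTop ℕ∞) ≠ 0 := by simp
  set P := hΦs.contDiffAt.toOpenPartialHomeomorph Φ (hΦd p) hne with hP
  have hPd (z : ℝ × ℝ) (hz : z ∈ P.target) : HasFDerivAt P.symm _ z :=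
    P.hasFDerivAt_symm hz (hΦd (P.symm z))
  refine ⟨P.target, P.open_target, ?_, fun z => (P.symm z).2, fun z hz => ?_, fun z hz => ?_⟩
  · have h := hΦs.contDiffAt.image_mem_toOpenPartialHomeomorph_target (hΦd p) hne
    exact (show Φ p = p from Prod.ext rfl (hφ₀ p.2)) ▸ h
  · exact (contDiff_snd.contDiffAt.comp z
      (P.contDiffAt_symm hz (hΦd (P.symm z)) hΦs.contDiffAt)).contDiffWithinAt
  · refine ⟨(E (P.symm z))⁻¹, inv_ne_zero (hE _), ?_⟩
    refine (hPd z hz).snd.congr_fderiv ?_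
    rw [show Φ (P.symm z) = z from P.right_inv hz]
    rfl

/-- Every Pfaffian form `δξ = F₁ dx₁ + F₂ dx₂` in two variables with smooth, nowhere-zero
coefficient functions on an open set `B ⊆ ℝ²` is locally integrable on `B`. -/
theorem pfaffian_two_variables_locally_integrable
    (B : Set (Fin 2 → ℝ)) (hB : IsOpen B)
    (F₁ F₂ : (Fin 2 → ℝ) → ℝ)
    (hF₁ : ContDiffOn ℝ (⊤ : ℕ∞) F₁ B) (hF₂ : ContDiffOn ℝ (⊤ : ℕ∞) F₂ B)
    (hF₁0 : ∀ x ∈ B, F₁ x ≠ 0) (hF₂0 : ∀ x ∈ B, F₂ x ≠ 0) :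
    ∀ p ∈ B, ∃ A : Set (Fin 2 → ℝ), A ⊆ B ∧ IsOpen A ∧ p ∈ A ∧
      ∃ μ ψ : (Fin 2 → ℝ) → ℝ,
        (∀ x ∈ A, μ x ≠ 0) ∧ ContDiffOn ℝ (⊤ : ℕ∞) ψ A ∧
        (∀ x ∈ A, F₁ x = μ x * pd ψ 0 x) ∧
        (∀ x ∈ A, F₂ x = μ x * pd ψ 1 x) := by
  intro p hp
  let e := ContinuousLinearEquiv.finTwoArrow ℝ ℝ
  have he (x : Fin 2 → ℝ) : e x = (x 0, x 1) := rfl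
  obtain ⟨r, hr, hrB⟩ := Metric.isOpen_iff.1 (hB.preimage e.symm.continuous) (e p)
    (by simpa using hp)
  let χ : ContDiffBump (e p) := ⟨r / 3, r / 2, by positivity, by linarith⟩
  let B' : Set (ℝ × ℝ) := e.symm ⁻¹' B
  have hχB : tsupport χ ⊆ B' := by
    rw [χ.tsupport_eq]
    exact (Metric.closedBall_subset_ball (half_lt_self hr)).trans hrB
  let g : ℝ × ℝ → ℝ := fun z => -(F₁ (e.symm z) / F₂ (e.symm z))
  have hg : ContDiffOn ℝ (⊤ : ℕ∞) g B' :=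
    ((hF₁.comp e.symm.contDiff.contDiffOn fun _ h => h).div
      (hF₂.comp e.symm.contDiff.contDiffOn fun _ h => h) fun z hz => hF₂0 _ hz).neg
  have hf : ContDiff ℝ (⊤ : ℕ∞) fun z => χ z * g z := by
    refine contDiff_iff_contDiffAt.2 fun z => ?_
    by_cases hz : z ∈ tsupport χ
    · exact χ.contDiffAt.mul
        (hg.contDiffAt ((hB.preimage e.symm.continuous).mem_nhds (hχB hz)))
    · refine contDiffAt_const (c := (0 : ℝ)) |>.congr_of_eventuallyEq ?_
      filter_upwards [notMem_tsupport_iff_eventuallyEq.1 hz] with w hw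
      simp [hw]
  obtain ⟨U, hU, hpU, ψ, hψ, hψd⟩ := exists_contDiffOn_firstIntegral hf
    (χ.hasCompactSupport.mul_right) (e p)
  have hAB (x : Fin 2 → ℝ) (hx : e x ∈ Metric.ball (e p) (r / 3)) : x ∈ B := by
    simpa using hrB (Metric.ball_subset_ball (by linarith) hx)
  have hpd (x : Fin 2 → ℝ) (hx : e x ∈ U ∩ Metric.ball (e p) (r / 3)) :
      pd (ψ ∘ e) 1 x ≠ 0 ∧ F₂ x * pd (ψ ∘ e) 0 x = F₁ x * pd (ψ ∘ e) 1 x := by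
    obtain ⟨k, hk, hd⟩ := hψd (e x) hx.1
    have h := (hd.comp x e.hasFDerivAt).fderiv
    have hχ : χ (e x) = 1 := χ.one_of_mem_closedBall (Metric.ball_subset_closedBall hx.2)
    have h2 := hF₂0 x (hAB x hx.2)
    simp only [pd, h, hχ, g, e.symm_apply_apply]
    simp [he, hk]
    field_simp
  refine ⟨e ⁻¹' (U ∩ Metric.ball (e p) (r / 3)), fun x hx => hAB x hx.2,
    (hU.inter Metric.isOpen_ball).preimage e.continuous,
    ⟨hpU, Metric.mem_ball_self (by positivity)⟩, fun x => F₂ x / pd (ψ ∘ e) 1 x, ψ ∘ e,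
    fun x hx => div_ne_zero (hF₂0 x (hAB x hx.2)) (hpd x hx).1,
    hψ.comp e.contDiff.contDiffOn fun x hx => hx.1, fun x hx => ?_, fun x hx => ?_⟩
  · rw [div_mul_eq_mul_div, (hpd x hx).2, mul_div_cancel_right₀ _ (hpd x hx).1]
  · rw [div_mul_cancel₀ _ (hpd x hx).1]
end

section
/- (Clairaut's necessary condition) Let B ⊆ ℝⁿ be an open set, let F₁,…,Fₙ : B → ℝ be C^∞ functions, and suppose there exist C^∞ functions μ, ψ : B → ℝ with μ nowhere zero on B and Fᵢ = μ · ∂ψ/∂xᵢ on B for all i. Then for all indices i, j, k the quantity R_{ijk} := Fᵢ(∂F_k/∂xⱼ − ∂Fⱼ/∂x_k) + Fⱼ(∂Fᵢ/∂x_k − ∂F_k/∂xᵢ) + F_k(∂Fⱼ/∂xᵢ − ∂Fᵢ/∂xⱼ) vanishes identically on B. -/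
open Set

/-- The Clairaut quantity
`R_{ijk} = Fᵢ(∂F_k/∂xⱼ − ∂Fⱼ/∂x_k) + Fⱼ(∂Fᵢ/∂x_k − ∂F_k/∂xᵢ) + F_k(∂Fⱼ/∂xᵢ − ∂Fᵢ/∂xⱼ)`. -/
noncomputable def clairautR {n : ℕ} (F : Fin n → (Fin n → ℝ) → ℝ) (i j k : Fin n)
    (x : Fin n → ℝ) : ℝ :=
  F i x * (pd (F k) j x - pd (F j) k x) + F j x * (pd (F i) k x - pd (F k) i x)
    + F k x * (pd (F j) i x - pd (F i) j x)

/-- Partial derivatives of a function that is `C²` at a point commute there. -/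
theorem pd_pd_comm {n : ℕ} {f : (Fin n → ℝ) → ℝ} {x : Fin n → ℝ} (hf : ContDiffAt ℝ 2 f x)
    (i j : Fin n) : pd (pd f i) j x = pd (pd f j) i x := by
  have hd : DifferentiableAt ℝ (fderiv ℝ f) x :=
    (hf.fderiv_right (m := 1) (by norm_num)).differentiableAt one_ne_zero
  have key (a b : Fin n) :
      pd (pd f a) b x = fderiv ℝ (fderiv ℝ f) x (Pi.single b 1) (Pi.single a 1) := by
    have h : HasFDerivAt (pd f a) _ x :=
      hd.hasFDerivAt.clm_apply (hasFDerivAt_const (Pi.single a 1 : Fin n → ℝ) x)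
    simp [pd.eq_def (pd f a), h.fderiv]
  rw [key, key]
  exact (hf.isSymmSndFDerivAt (by simp)).eq _ _

/-- The partial derivatives of a function that is `C²` at a point are differentiable there. -/
theorem differentiableAt_pd {n : ℕ} {f : (Fin n → ℝ) → ℝ} {x : Fin n → ℝ}
    (hf : ContDiffAt ℝ 2 f x) (i : Fin n) : DifferentiableAt ℝ (pd f i) x :=
  ((hf.fderiv_right (m := 1) (by norm_num)).differentiableAt one_ne_zero).clm_apply
    (differentiableAt_const _)

/-- Leibniz rule for partial derivatives. -/
theorem pd_mul {n : ℕ} {f g : (Fin n → ℝ) → ℝ} {x : Fin n → ℝ} (hf : DifferentiableAt ℝ f x)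
    (hg : DifferentiableAt ℝ g x) (i : Fin n) :
    pd (fun y => f y * g y) i x = f x * pd g i x + pd f i x * g x := by
  simp [pd, fderiv_fun_mul hf hg, mul_comm]

/-- (Clairaut's necessary condition) If the Pfaffian form with smooth coefficients `F i`
is integrable on the open set `B` (with smooth `μ`, `ψ`, `μ` nowhere zero and
`Fᵢ = μ · ∂ψ/∂xᵢ`), then `R_{ijk} = 0` identically on `B`. -/
theorem clairaut_necessary_condition
    (n : ℕ) (B : Set (Fin n → ℝ)) (hB : IsOpen B)
    (F : Fin n → (Fin n → ℝ) → ℝ)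
    (hF : ∀ i, ContDiffOn ℝ (⊤ : ℕ∞) (F i) B)
    (μ ψ : (Fin n → ℝ) → ℝ)
    (hμ : ContDiffOn ℝ (⊤ : ℕ∞) μ B) (hψ : ContDiffOn ℝ (⊤ : ℕ∞) ψ B)
    (hμ0 : ∀ x ∈ B, μ x ≠ 0)
    (hint : ∀ i, ∀ x ∈ B, F i x = μ x * pd ψ i x) :
    ∀ i j k, ∀ x ∈ B, clairautR F i j k x = 0 := by
  intro i j k x hx
  have hBx : B ∈ nhds x := hB.mem_nhds hx
  have hμx : DifferentiableAt ℝ μ x := (hμ.contDiffAt hBx).differentiableAt (by simp)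
  have hψx : ContDiffAt ℝ 2 ψ x :=
    (hψ.contDiffAt hBx).of_le (WithTop.coe_le_coe.2 (le_top : (2 : ℕ∞) ≤ ⊤))
  have hpd (a b : Fin n) : pd (F a) b x = μ x * pd (pd ψ a) b x + pd μ b x * pd ψ a x := by
    have h : F a =ᶠ[nhds x] fun y => μ y * pd ψ a y := by
      filter_upwards [hBx] with y hy using hint a y hy
    rw [← pd_mul hμx (differentiableAt_pd hψx a), pd, pd, h.fderiv_eq]
  simp only [clairautR, hpd, hint _ x hx, pd_pd_comm hψx k j, pd_pd_comm hψx k i,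
    pd_pd_comm hψx j i]
  ring
end

section
/- (Clairaut's sufficient condition) Let B ⊆ ℝⁿ be an open set and let F₁,…,Fₙ : B → ℝ be C^∞ functions with (F₁(x),…,Fₙ(x)) ≠ 0 for every x ∈ B, the coefficient functions of the Pfaffian form δξ = Σᵢ Fᵢ dxᵢ. If R_{ijk} = 0 identically on B for all indices i, j, k, then δξ is locally integrable on B: every point of B has an open neighborhood A ⊆ B on which there exist functions μ, ψ : A → ℝ, with μ nowhere zero and ψ of class C^∞, such that Fᵢ = μ · ∂ψ/∂xᵢ on A for all i. -/
open Set

/-- The Pfaffian form with coefficients `F i` is integrable on `A` if there are `μ`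
nowhere zero on `A` and a smooth `ψ` with `Fᵢ = μ · ∂ψ/∂xᵢ` on `A`. -/
def IsIntegrablePfaffOn {n : ℕ} (F : Fin n → (Fin n → ℝ) → ℝ) (A : Set (Fin n → ℝ)) : Prop :=
  ∃ μ ψ : (Fin n → ℝ) → ℝ, (∀ x ∈ A, μ x ≠ 0) ∧ ContDiffOn ℝ (⊤ : ℕ∞) ψ A ∧
    ∀ i, ∀ x ∈ A, F i x = μ x * pd ψ i x

section
open scoped ContDiff Topology unitInterval
universe u
variable {X : Type*} [TopologicalSpace X] [CompactSpace X]
  {E F : Type u} [NormedAddCommGroup E] [NormedSpace ℝ E] [NormedAddCommGroup F] [NormedSpace ℝ F]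

/-- Pointwise application, as a continuous bilinear map on spaces of continuous maps. -/
noncomputable def pointwiseApplyCLM (X : Type*) [TopologicalSpace X] [CompactSpace X]
    (E F : Type*) [NormedAddCommGroup E] [NormedSpace ℝ E] [NormedAddCommGroup F]
    [NormedSpace ℝ F] : C(X, E →L[ℝ] F) →L[ℝ] C(X, E) →L[ℝ] C(X, F) :=
  LinearMap.mkContinuous₂
    (LinearMap.mk₂ ℝ (fun A α => ⟨fun t => A t (α t), by fun_prop⟩ :
        C(X, E →L[ℝ] F) → C(X, E) → C(X, F))
      (fun _ _ _ => by ext; simp) (fun _ _ _ => by ext; simp)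
      (fun _ _ _ => by ext; simp) (fun _ _ _ => by ext; simp)) 1 fun A α => by
    rw [one_mul, ContinuousMap.norm_le _ (by positivity)]
    intro t
    exact (A t).le_of_opNorm_le_of_le (A.norm_coe_le_norm t) (α.norm_coe_le_norm t)

@[simp]
theorem pointwiseApplyCLM_apply (A : C(X, E →L[ℝ] F)) (α : C(X, E)) (t : X) :
    pointwiseApplyCLM X E F A α t = A t (α t) := rfl

theorem hasFDerivAt_continuousMap_comp (f : C(E, F)) (f' : C(E, E →L[ℝ] F))
    (hf : ∀ y, HasFDerivAt f (f' y) y) (α : C(X, E)) :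
    HasFDerivAt (fun β : C(X, E) => f.comp β) (pointwiseApplyCLM X E F (f'.comp α)) α := by
  rw [hasFDerivAt_iff_isLittleO_nhds_zero, Asymptotics.isLittleO_iff]
  intro ε hε
  have hcont : ContinuousAt (fun β : C(X, E) => f'.comp β) α :=
    (ContinuousMap.continuous_postcomp f').continuousAt
  obtain ⟨δ, hδ, hball⟩ := (Metric.continuousAt_iff (f := fun β : C(X, E) => f'.comp β)).1
    hcont ε hε
  filter_upwards [Metric.ball_mem_nhds 0 hδ] with h hh
  rw [mem_ball_zero_iff] at hh
  rw [ContinuousMap.norm_le _ (by positivity)]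
  intro t
  have key : ∀ y ∈ segment ℝ (α t) (α t + h t), ‖f' y - f' (α t)‖ ≤ ε := by
    rintro y hy
    rw [segment_eq_image'] at hy
    obtain ⟨s, hs, rfl⟩ := hy
    have hd : dist (α + s • h) α < δ := by
      rw [dist_eq_norm, add_sub_cancel_left, norm_smul, Real.norm_of_nonneg hs.1]
      nlinarith [norm_nonneg h, hs.2]
    have := (ContinuousMap.norm_coe_le_norm (f'.comp (α + s • h) - f'.comp α) t).trans
      (dist_eq_norm (f'.comp (α + s • h)) (f'.comp α) ▸ (hball hd).le)
    simpa using this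
  have := (convex_segment (α t) (α t + h t)).norm_image_sub_le_of_norm_hasFDerivWithin_le'
    (fun y _ => (hf y).hasFDerivWithinAt) key (left_mem_segment ℝ _ _)
    (right_mem_segment ℝ _ _)
  simp only [add_sub_cancel_left] at this
  calc _ = ‖f (α t + h t) - f (α t) - f' (α t) (h t)‖ := by simp
    _ ≤ ε * ‖h t‖ := this
    _ ≤ ε * ‖h‖ := by gcongr; exact h.norm_coe_le_norm t

theorem contDiff_continuousMap_comp_nat (n : ℕ) :
    ∀ {F : Type u} [NormedAddCommGroup F] [NormedSpace ℝ F] (f : C(E, F)),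
      ContDiff ℝ n f → ContDiff ℝ n fun α : C(X, E) => f.comp α := by
  induction n with
  | zero =>
    intro F _ _ f _
    exact contDiff_zero.2 (ContinuousMap.continuous_postcomp f)
  | succ n ih =>
    intro F _ _ f hf
    push_cast at hf ⊢
    obtain ⟨f', hf', hd⟩ := contDiff_succ_iff_hasFDerivAt.1 hf
    exact contDiff_succ_iff_hasFDerivAt.2 ⟨_, (pointwiseApplyCLM X E F).contDiff.comp
      (ih ⟨f', hf'.continuous⟩ hf'), hasFDerivAt_continuousMap_comp f ⟨f', hf'.continuous⟩ hd⟩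

theorem contDiff_continuousMap_comp (f : C(E, F)) (hf : ContDiff ℝ ∞ f) :
    ContDiff ℝ ∞ fun α : C(X, E) => f.comp α :=
  contDiff_infty.2 fun n => contDiff_continuousMap_comp_nat n f (contDiff_infty.1 hf n)

/-- The Volterra operator `α ↦ (t ↦ ∫₀ᵗ α)` on `C([0, 1], E)`. -/
noncomputable def volterraCLM (E : Type*) [NormedAddCommGroup E] [NormedSpace ℝ E] :
    C(I, E) →L[ℝ] C(I, E) :=
  LinearMap.mkContinuous
    { toFun := fun α => ⟨fun t => ∫ s in (0 : ℝ)..t, α (projIcc 0 1 zero_le_one s),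
        (intervalIntegral.continuous_primitive
          (fun a b => (α.continuous.comp continuous_projIcc).intervalIntegrable a b) 0).comp
          continuous_subtype_val⟩
      map_add' := fun α β => by
        ext t
        exact intervalIntegral.integral_add
          ((α.continuous.comp continuous_projIcc).intervalIntegrable _ _)
          ((β.continuous.comp continuous_projIcc).intervalIntegrable _ _)
      map_smul' := fun c α => by
        ext t
        exact intervalIntegral.integral_smul c _ } 1 fun α => by
    rw [one_mul, ContinuousMap.norm_le _ (norm_nonneg _)]
    intro t
    refine (intervalIntegral.norm_integral_le_of_norm_le_const
      fun s _ => α.norm_coe_le_norm _).trans ?_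
    rw [sub_zero, abs_of_nonneg t.2.1]
    exact mul_le_of_le_one_right (norm_nonneg _) t.2.2

theorem volterraCLM_zero (α : C(I, E)) : volterraCLM E α 0 = 0 :=
  intervalIntegral.integral_same

theorem hasDerivWithinAt_volterraCLM [CompleteSpace E] (α : C(I, E)) (t : I) :
    HasDerivWithinAt (fun s => volterraCLM E α (projIcc 0 1 zero_le_one s)) (α t)
      (Icc 0 1) t := by
  have hc : Continuous fun s => α (projIcc 0 1 zero_le_one s) :=
    α.continuous.comp continuous_projIcc
  have h := (hc.integral_hasStrictDerivAt 0 (t : ℝ)).hasDerivAt.hasDerivWithinAt (s := Icc 0 1)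
  rw [projIcc_val] at h
  refine h.congr_of_mem (fun s hs => ?_) t.2
  rw [projIcc_of_mem zero_le_one hs]
  rfl

theorem ContDiff.exists_contDiffOn_localInverse {V W : Type*} [NormedAddCommGroup V]
    [NormedSpace ℝ V] [CompleteSpace V] [NormedAddCommGroup W] [NormedSpace ℝ W]
    {H : V → W} (hH : ContDiff ℝ ∞ H) {e : V ≃L[ℝ] W} {z : V}
    (he : HasFDerivAt H (e : V →L[ℝ] W) z) :
    ∃ (U : Set W) (G : W → V), IsOpen U ∧ H z ∈ U ∧ ContDiffOn ℝ ∞ G U ∧ G (H z) = z ∧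
      ∀ w ∈ U, H (G w) = w := by
  have h0 : (∞ : WithTop ℕ∞) ≠ 0 := by simp
  set Φ := hH.contDiffAt.toOpenPartialHomeomorph H he h0
  have hz : z ∈ Φ.source := hH.contDiffAt.mem_toOpenPartialHomeomorph_source he h0
  have hHz : H z ∈ Φ.target := Φ.map_source hz
  have hΦz : Φ.symm (H z) = z := Φ.left_inv hz
  have hcont : ContinuousAt (fun w => fderiv ℝ H (Φ.symm w)) (H z) :=
    (hH.continuous_fderiv h0).continuousAt.comp (Φ.continuousAt_symm hHz)
  have hev : ∀ᶠ w in 𝓝 (H z), w ∈ Φ.target ∧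
      fderiv ℝ H (Φ.symm w) ∈ range ((↑) : (V ≃L[ℝ] W) → V →L[ℝ] W) := by
    refine (Φ.open_target.eventually_mem hHz).and (hcont ?_)
    simpa only [hΦz, he.fderiv] using e.nhds
  obtain ⟨U, hU, hUo, hzU⟩ := eventually_nhds_iff.1 hev
  refine ⟨U, Φ.symm, hUo, hzU, fun w hw => ?_, hΦz, fun w hw => Φ.right_inv (hU w hw).1⟩
  obtain ⟨ht, e', he'⟩ := hU w hw
  refine (Φ.contDiffAt_symm (f₀' := e') ht ?_ hH.contDiffAt).contDiffWithinAt
  rw [he']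
  exact (hH.differentiable h0 _).hasFDerivAt

/-- The map sending `(x, α)` to the curve `t ↦ (α t, x)`. -/
noncomputable def pairConstCLM (E : Type*) [NormedAddCommGroup E] [NormedSpace ℝ E] :
    E × C(I, E) →L[ℝ] C(I, E × E) :=
  (ContinuousLinearMap.inl ℝ E E).compLeftContinuous ℝ I ∘L ContinuousLinearMap.snd ℝ E C(I, E) +
    (ContinuousLinearMap.inr ℝ E E).compLeftContinuous ℝ I ∘L ContinuousLinearMap.const ℝ I ∘L
      ContinuousLinearMap.fst ℝ E C(I, E)

@[simp]
theorem pairConstCLM_apply (z : E × C(I, E)) (t : I) : pairConstCLM E z t = (z.2 t, z.1) := by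
  simp [pairConstCLM]

/-- Smooth dependence on the initial value `x` (which may also enter the equation as a parameter)
of the solution of `y' = f (y, x)`, `y 0 = x` on `[0, 1]`, for `x` near a point `p` such that
`f (·, p)` vanishes. -/
theorem exists_contDiffOn_solution [CompleteSpace E] {f : E × E → E} (hf : ContDiff ℝ ∞ f) {p : E}
    (hp : ∀ y, f (y, p) = 0) :
    ∃ (U : Set E) (γ : E → C(I, E)), IsOpen U ∧ p ∈ U ∧ ContDiffOn ℝ ∞ γ U ∧
      γ p = ContinuousMap.const I p ∧
      (∀ x ∈ U, γ x 0 = x ∧ ∀ t : I, HasDerivWithinAt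
        (fun s => γ x (projIcc 0 1 zero_le_one s)) (f (γ x t, x)) (Icc 0 1) t) ∧
      ∀ x ∈ U, ∀ v, fderiv ℝ γ x v 0 = v ∧ ∀ t : I, HasDerivWithinAt
        (fun s => fderiv ℝ γ x v (projIcc 0 1 zero_le_one s))
        (fderiv ℝ f (γ x t, x) (fderiv ℝ γ x v t, v)) (Icc 0 1) t := by
  have h0 : (∞ : WithTop ℕ∞) ≠ 0 := by simp
  set fc : C(E × E, E) := ⟨f, hf.continuous⟩
  set fc' : C(E × E, E × E →L[ℝ] E) := ⟨fderiv ℝ f, hf.continuous_fderiv h0⟩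
  have hfc (α : C(I, E × E)) : HasFDerivAt (fun β => fc.comp β)
      (pointwiseApplyCLM I (E × E) E (fc'.comp α)) α :=
    hasFDerivAt_continuousMap_comp fc fc' (fun y => (hf.differentiable h0 y).hasFDerivAt) α
  let R : E × C(I, E) → C(I, E) := fun z =>
    ContinuousLinearMap.const ℝ I z.1 + volterraCLM E (fc.comp (pairConstCLM E z))
  let R' : E × C(I, E) → E × C(I, E) →L[ℝ] C(I, E) := fun z =>
    ContinuousLinearMap.const ℝ I ∘L ContinuousLinearMap.fst ℝ E C(I, E) + volterraCLM E ∘L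
      pointwiseApplyCLM I (E × E) E (fc'.comp (pairConstCLM E z)) ∘L pairConstCLM E
  have hR : ContDiff ℝ ∞ R :=
    (ContinuousLinearMap.contDiff _ |>.comp contDiff_fst).add
      ((volterraCLM E).contDiff.comp
        ((contDiff_continuousMap_comp fc hf).comp (pairConstCLM E).contDiff))
  have hR' (z) : HasFDerivAt R (R' z) z :=
    ((ContinuousLinearMap.const ℝ I ∘L ContinuousLinearMap.fst ℝ E C(I, E)).hasFDerivAt).add
      ((volterraCLM E).hasFDerivAt.comp z
        ((hfc _).comp z (pairConstCLM E).hasFDerivAt))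
  let H : E × C(I, E) → E × C(I, E) := fun z => (z.1, z.2 - R z)
  have hH : ContDiff ℝ ∞ H := contDiff_fst.prodMk (contDiff_snd.sub hR)
  set z₀ : E × C(I, E) := (p, ContinuousMap.const I p)
  have hz₀ : R' z₀ = R' z₀ ∘L ContinuousLinearMap.inl ℝ E C(I, E) ∘L
      ContinuousLinearMap.fst ℝ E C(I, E) := by
    have hf0 (w : E) : fderiv ℝ f (p, p) (w, 0) = 0 := by
      have h1 : HasFDerivAt (fun y => f (y, p))
          (fderiv ℝ f (p, p) ∘L ContinuousLinearMap.inl ℝ E E) p :=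
        HasFDerivAt.comp (f := fun y => (y, p)) p
          (hf.differentiable h0 (p, p)).hasFDerivAt (hasFDerivAt_prodMk_left p p)
      have h2 : HasFDerivAt (fun y => f (y, p)) (0 : E →L[ℝ] E) p := by
        simpa only [hp] using hasFDerivAt_const (0 : E) p
      exact congr($(h1.unique h2) w)
    refine ContinuousLinearMap.ext fun z => ?_
    have hz (t : I) : fderiv ℝ f (p, p) (z.2 t, z.1) = fderiv ℝ f (p, p) (0, z.1) := by
      rw [← sub_eq_zero, ← map_sub]
      simpa using hf0 (z.2 t)
    simp only [R', _root_.add_apply, ContinuousLinearMap.comp_apply]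
    congr 2
    ext t
    simpa [fc', z₀] using hz t
  let e : (E × C(I, E)) ≃L[ℝ] E × C(I, E) := (ContinuousLinearEquiv.refl ℝ E).skewProd
    (ContinuousLinearEquiv.refl ℝ C(I, E)) (-(R' z₀ ∘L ContinuousLinearMap.inl ℝ E C(I, E)))
  have he : HasFDerivAt H (e : E × C(I, E) →L[ℝ] E × C(I, E)) z₀ := by
    refine (hasFDerivAt_fst.prodMk (hasFDerivAt_snd.sub (hR' z₀))).congr_fderiv ?_
    refine ContinuousLinearMap.ext fun z => ?_
    rw [hz₀]
    simp [e, sub_eq_add_neg]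
  have hHz : H z₀ = (p, 0) := by
    have : fc.comp (pairConstCLM E z₀) = 0 := by
      ext t
      simp [fc, z₀, hp]
    simp only [H, R, this, map_zero, add_zero, Prod.mk.injEq, z₀, true_and]
    exact sub_self _
  obtain ⟨U, G, hUo, hzU, hG, hGz, hHG⟩ := hH.exists_contDiffOn_localInverse he
  rw [hHz] at hzU hGz
  obtain ⟨γ, hγG⟩ : ∃ γ : E → C(I, E), ∀ x, γ x = (G (x, 0)).2 := ⟨_, fun _ => rfl⟩
  have hfix (x) (hx : (x, (0 : C(I, E))) ∈ U) : γ x = R (x, γ x) := by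
    have h1 : (G (x, 0)).1 = x := congr($(hHG _ hx).1)
    have h2 : (G (x, 0)).2 - R (G (x, 0)) = 0 := congr($(hHG _ hx).2)
    rw [sub_eq_zero] at h2
    have h3 : G (x, 0) = (x, γ x) := Prod.ext h1 (hγG x).symm
    rwa [h3] at h2
  have hVo : IsOpen {x : E | (x, (0 : C(I, E))) ∈ U} := hUo.preimage (by fun_prop)
  have hγ : ContDiffOn ℝ ∞ γ {x : E | (x, (0 : C(I, E))) ∈ U} :=
    (contDiff_snd.comp_contDiffOn (hG.comp (contDiff_id.prodMk contDiff_const).contDiffOn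
      fun x hx => hx)).congr fun x _ => hγG x
  refine ⟨{x | (x, 0) ∈ U}, γ, hVo, hzU, hγ, by rw [hγG, hGz], ?_, ?_⟩
  · intro x hx
    have hx' := hfix x hx
    generalize γ x = α at hx' ⊢
    refine ⟨?_, fun t => ?_⟩
    · rw [hx']
      simp [R, volterraCLM_zero]
    · have := (hasDerivWithinAt_volterraCLM (fc.comp (pairConstCLM E (x, α))) t).const_add x
      simp only [ContinuousMap.comp_apply, pairConstCLM_apply] at this
      refine this.congr_of_mem (fun s _ => ?_) t.2
      conv_lhs => rw [hx']
      rfl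
  · intro x hx v
    have hd : HasFDerivAt γ (fderiv ℝ γ x) x :=
      ((hγ.contDiffAt (hVo.mem_nhds hx)).differentiableAt h0).hasFDerivAt
    generalize fderiv ℝ γ x = D at hd ⊢
    have hd' : HasFDerivAt γ (R' (x, γ x) ∘L
        (ContinuousLinearMap.id ℝ E).prod D) x :=
      ((hR' _).comp x ((hasFDerivAt_id x).prodMk hd)).congr_of_eventuallyEq
        (by filter_upwards [hVo.mem_nhds hx] with y hy using hfix y hy)
    have hDv : D v = R' (x, γ x) (v, D v) := congr($(hd.unique hd') v)
    generalize D v = β at hDv ⊢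
    refine ⟨?_, fun t => ?_⟩
    · rw [hDv]
      simp [R', volterraCLM_zero]
    · have := (hasDerivWithinAt_volterraCLM (pointwiseApplyCLM I (E × E) E
        (fc'.comp (pairConstCLM E (x, γ x))) (pairConstCLM E (v, β))) t).const_add v
      simp only [pointwiseApplyCLM_apply, ContinuousMap.comp_apply, pairConstCLM_apply] at this
      refine this.congr_of_mem (fun s _ => ?_) t.2
      conv_lhs => rw [hDv]
      rfl

theorem eq_of_hasDerivWithinAt_zero {g : ℝ → F}
    (hg : ∀ s ∈ Icc (0 : ℝ) 1, HasDerivWithinAt g 0 (Icc 0 1) s) : g 0 = g 1 :=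
  (convex_Icc (0 : ℝ) 1).is_const_of_fderivWithin_eq_zero (𝕜 := ℝ)
    (fun s hs => (hg s hs).differentiableWithinAt)
    (fun s hs => by
      rw [(hg s hs).hasFDerivWithinAt.fderivWithin (uniqueDiffOn_Icc zero_lt_one s hs)]
      simp)
    (left_mem_Icc.2 zero_le_one) (right_mem_Icc.2 zero_le_one)

theorem eq_exp_mul_of_hasDerivWithinAt {g c : ℝ → ℝ} (hc : Continuous c)
    (hg : ∀ s ∈ Icc (0 : ℝ) 1, HasDerivWithinAt g (c s * g s) (Icc 0 1) s) :
    g 1 = Real.exp (∫ s in (0 : ℝ)..1, c s) * g 0 := by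
  have hd : ∀ s ∈ Icc (0 : ℝ) 1, HasDerivWithinAt
      (fun s => Real.exp (-∫ r in (0 : ℝ)..s, c r) * g s) 0 (Icc 0 1) s := by
    intro s hs
    have h1 := ((hc.integral_hasStrictDerivAt 0 s).hasDerivAt.neg.exp.hasDerivWithinAt
      (s := Icc 0 1)).mul (hg s hs)
    exact h1.congr_deriv (by ring)
  have h := eq_of_hasDerivWithinAt_zero hd
  simp only [intervalIntegral.integral_same, neg_zero, Real.exp_zero, one_mul] at h
  rw [h, ← mul_assoc, ← Real.exp_add, add_neg_cancel, Real.exp_zero, one_mul]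

theorem ContDiffOn.exists_contDiff_eventuallyEq {V W : Type*} [NormedAddCommGroup V]
    [NormedSpace ℝ V] [HasContDiffBump V] [FiniteDimensional ℝ V] [NormedAddCommGroup W]
    [NormedSpace ℝ W] {f : V → W} {B : Set V} {p : V} (hf : ContDiffOn ℝ ∞ f B)
    (hB : B ∈ 𝓝 p) : ∃ g : V → W, ContDiff ℝ ∞ g ∧ g =ᶠ[𝓝 p] f := by
  obtain ⟨r, hr, hrB⟩ := Metric.mem_nhds_iff.1 hB
  let b : ContDiffBump p := ⟨r / 4, r / 2, by positivity, by linarith⟩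
  refine ⟨fun x => b x • f x, contDiff_iff_contDiffAt.2 fun x => ?_, ?_⟩
  · by_cases hx : x ∈ Metric.ball p r
    · exact b.contDiff.contDiffAt.smul
        (hf.contDiffAt (Filter.mem_of_superset (Metric.isOpen_ball.mem_nhds hx) hrB))
    · have hx' : x ∉ tsupport b := fun h => hx <| by
        rw [b.tsupport_eq] at h
        exact Metric.closedBall_subset_ball (by simp only [b]; linarith) h
      refine (contDiffAt_const (c := (0 : W))).congr_of_eventuallyEq ?_
      filter_upwards [(isClosed_tsupport b).isOpen_compl.mem_nhds hx'] with y hy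
      rw [image_eq_zero_of_notMem_tsupport hy, zero_smul]
  · filter_upwards [b.eventuallyEq_one] with x hx
    simp [hx]

/-- Let `η` be a one-form with `η ∧ dη = 0` that annihilates the vector fields `f (·, x)`. Along
an integral curve of `f (·, x)`, the pairing of `η` with a solution of the linearized equation
satisfies a homogeneous linear equation whose coefficient does not depend on that solution. -/
theorem hasDerivWithinAt_apply_of_wedge_eq_zero {f : E × E → E} {f' : E × E →L[ℝ] E}
    {η : E → E →L[ℝ] ℝ} {η' : E →L[ℝ] E →L[ℝ] ℝ} {y β : ℝ → E} {x v N : E} {S : Set ℝ} {s : ℝ}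
    (hf : HasFDerivAt f f' (y s, x)) (hη : HasFDerivAt η η' (y s))
    (hηf : ∀ᶠ a in 𝓝 (y s), ∀ b, η a (f (a, b)) = 0)
    (hwedge : ∀ u w, η (y s) N * (η' u w - η' w u) + η (y s) u * (η' w N - η' N w) +
      η (y s) w * (η' N u - η' u N) = 0)
    (hN : η (y s) N ≠ 0) (hy : HasDerivWithinAt y (f (y s, x)) S s)
    (hβ : HasDerivWithinAt β (f' (β s, v)) S s) :
    HasDerivWithinAt (fun s => η (y s) (β s))
      (-(η' N (f (y s, x)) - η' (f (y s, x)) N) / η (y s) N * η (y s) (β s)) S s := by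
  have hd : HasDerivWithinAt (fun s => η (y s) (β s))
      (η' (f (y s, x)) (β s) + η (y s) (f' (β s, v))) S s :=
    (hη.comp_hasDerivWithinAt s hy).clm_apply hβ
  have h1 : HasFDerivAt (fun z : E × E => η z.1 (f z)) _ (y s, x) :=
    (HasFDerivAt.comp (f := Prod.fst) (y s, x) hη hasFDerivAt_fst).clm_apply hf
  have h2 : HasFDerivAt (fun z : E × E => η z.1 (f z)) (0 : E × E →L[ℝ] ℝ) (y s, x) := by
    refine (hasFDerivAt_const (0 : ℝ) _).congr_of_eventuallyEq ?_
    filter_upwards [continuousAt_fst.eventually hηf] with z hz using hz z.2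
  have h3 : η (y s) (f' (β s, v)) + η' (β s) (f (y s, x)) = 0 :=
    congr($(h1.unique h2) (β s, v))
  have hw := hwedge (f (y s, x)) (β s)
  rw [hηf.self_of_nhds x] at hw
  refine hd.congr_deriv ?_
  field_simp
  linear_combination hw + η (y s) N * h3

/-- Frobenius' theorem for a single one-form: if `η ∧ dη = 0` near a point where `η` does not
vanish, then `η` is locally a multiple of an exact form. -/
theorem exists_eq_smul_fderiv_of_wedge_eq_zero [FiniteDimensional ℝ E] {B : Set E}
    (hB : IsOpen B) {η : E → E →L[ℝ] ℝ} (hη : ContDiffOn ℝ ∞ η B) {p : E} (hpB : p ∈ B)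
    (hηp : η p ≠ 0)
    (hwedge : ∀ x ∈ B, ∀ u v w, η x u * (fderiv ℝ η x v w - fderiv ℝ η x w v) +
      η x v * (fderiv ℝ η x w u - fderiv ℝ η x u w) +
      η x w * (fderiv ℝ η x u v - fderiv ℝ η x v u) = 0) :
    ∃ A ⊆ B, IsOpen A ∧ p ∈ A ∧ ∃ μ ψ : E → ℝ, (∀ x ∈ A, μ x ≠ 0) ∧ ContDiffOn ℝ ∞ ψ A ∧
      ∀ x ∈ A, η x = μ x • fderiv ℝ ψ x := by
  have : CompleteSpace E := FiniteDimensional.complete ℝ E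
  have h0 : (∞ : WithTop ℕ∞) ≠ 0 := by simp
  obtain ⟨N, hN⟩ : ∃ N, η p N ≠ 0 := by
    by_contra! h
    exact hηp (ContinuousLinearMap.ext h)
  let lam : E →L[ℝ] ℝ := (η p N)⁻¹ • η p
  have hlam : lam N = 1 := by simp [lam, hN]
  let Q : E →L[ℝ] E := ContinuousLinearMap.id ℝ E - lam.smulRight N
  have hQ (v : E) : Q v = v - lam v • N := rfl
  have hQN : Q N = 0 := by simp [hQ, hlam]
  have hQQ (v : E) : Q (Q v) = Q v := by simp [hQ, hlam]
  have hηN : ContDiffOn ℝ ∞ (fun y => η y N) B := hη.clm_apply contDiffOn_const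
  have hB' : IsOpen (B ∩ {y | η y N ≠ 0}) :=
    hηN.continuousOn.isOpen_inter_preimage hB isOpen_ne
  obtain ⟨K, hK, hKη⟩ : ∃ K : E → E →L[ℝ] ℝ, ContDiff ℝ ∞ K ∧
      K =ᶠ[𝓝 p] fun y => (η y N)⁻¹ • η y :=
    ContDiffOn.exists_contDiff_eventuallyEq
      (((hηN.mono inter_subset_left).inv fun y hy => hy.2).smul (hη.mono inter_subset_left))
      (hB'.mem_nhds ⟨hpB, hN⟩)
  obtain ⟨r, hr, hrW⟩ := Metric.eventually_nhds_iff_ball.1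
    ((hB'.eventually_mem ⟨hpB, hN⟩).and hKη)
  set W := Metric.ball p r
  have hWo : IsOpen W := Metric.isOpen_ball
  let f : E × E → E := fun z => K z.1 (Q (z.2 - p)) • N - Q (z.2 - p)
  have hf : ContDiff ℝ ∞ f := by
    have hq : ContDiff ℝ ∞ fun z : E × E => Q (z.2 - p) :=
      Q.contDiff.comp (contDiff_snd.sub contDiff_const)
    exact (((hK.comp contDiff_fst).clm_apply hq).smul contDiff_const).sub hq
  have hfp (y : E) : f (y, p) = 0 := by simp [f]
  have hηf : ∀ y ∈ W, ∀ x, η y (f (y, x)) = 0 := by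
    intro y hy x
    obtain ⟨⟨-, hy'⟩, hKy⟩ := hrW y hy
    have hy' : η y N ≠ 0 := hy'
    simp only [f, hKy, map_sub, map_smul, smul_apply, smul_eq_mul]
    field_simp
    ring
  have hQf (z w : E × E) : Q (fderiv ℝ f z w) = -Q w.2 := by
    have h1 : HasFDerivAt (fun z => Q (f z)) (Q ∘L fderiv ℝ f z) z :=
      Q.hasFDerivAt.comp z (hf.differentiable h0 z).hasFDerivAt
    have h2 : HasFDerivAt (fun z => Q (f z)) (-(Q ∘L ContinuousLinearMap.snd ℝ E E)) z := by
      have : (fun z => Q (f z)) = fun z : E × E => -Q (z.2 - p) := by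
        ext z
        simp [f, hQN, hQQ]
      rw [this]
      exact (Q.hasFDerivAt.comp z (hasFDerivAt_snd.sub_const p)).neg
    exact congr($(h1.unique h2) w)
  obtain ⟨U, γ, hUo, hpU, hγ, hγp, hγd, hγv⟩ := exists_contDiffOn_solution hf hfp
  let A : Set E := U ∩ γ ⁻¹' Metric.ball (ContinuousMap.const I p) r
  have hAW : ∀ x ∈ A, ∀ t, γ x t ∈ W := fun x hx t =>
    (ContinuousMap.dist_apply_le_dist (g := ContinuousMap.const I p) t).trans_lt hx.2
  have hAo : IsOpen A := hγ.continuousOn.isOpen_inter_preimage hUo Metric.isOpen_ball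
  have hAB : A ⊆ B := fun x hx => by
    have := (hrW _ (hAW x hx 0)).1.1
    rwa [(hγd x hx.1).1] at this
  have hpA : p ∈ A := ⟨hpU, by simp [hγp, hr]⟩
  let ev : C(I, E) →L[ℝ] ℝ := lam ∘L ContinuousMap.evalCLM ℝ (1 : I)
  have hψ : ContDiffOn ℝ ∞ (fun x => ev (γ x)) A :=
    ev.contDiff.comp_contDiffOn (hγ.mono inter_subset_left)
  have hkey : ∀ x ∈ A, ∃ m : ℝ, m ≠ 0 ∧ η x = m • fderiv ℝ (fun x => ev (γ x)) x := by
    intro x hx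
    obtain ⟨hγ0, hγt⟩ := hγd x hx.1
    have hγB (t : I) : γ x t ∈ B := (hrW _ (hAW x hx t)).1.1
    have hγN (t : I) : η (γ x t) N ≠ 0 := (hrW _ (hAW x hx t)).1.2
    have hηd (t : I) : HasFDerivAt η (fderiv ℝ η (γ x t)) (γ x t) :=
      ((hη.contDiffAt (hB.mem_nhds (hγB t))).differentiableAt h0).hasFDerivAt
    let c : I → ℝ := fun t => -(fderiv ℝ η (γ x t) N (f (γ x t, x)) -
      fderiv ℝ η (γ x t) (f (γ x t, x)) N) / η (γ x t) N
    have hc : Continuous c := by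
      have h1 : Continuous fun t => η (γ x t) :=
        hη.continuousOn.comp_continuous (γ x).continuous hγB
      have h2 : Continuous fun t => fderiv ℝ η (γ x t) :=
        (hη.continuousOn_fderiv_of_isOpen hB (by simp)).comp_continuous (γ x).continuous hγB
      have h3 : Continuous fun t => f (γ x t, x) :=
        hf.continuous.comp ((γ x).continuous.prodMk continuous_const)
      exact ((((h2.clm_apply continuous_const).clm_apply h3).sub
        ((h2.clm_apply h3).clm_apply continuous_const)).neg).div
        (h1.clm_apply continuous_const) hγN
    have hcP : Continuous fun s => c (projIcc 0 1 zero_le_one s) := hc.comp continuous_projIcc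
    refine ⟨η (γ x 1) N / Real.exp (∫ s in (0 : ℝ)..1, c (projIcc 0 1 zero_le_one s)),
      div_ne_zero (hγN 1) (Real.exp_ne_zero _), ContinuousLinearMap.ext fun v => ?_⟩
    have hfd : fderiv ℝ (fun x => ev (γ x)) x v = lam (fderiv ℝ γ x v 1) := by
      have h1 : HasFDerivAt γ (fderiv ℝ γ x) x :=
        ((hγ.contDiffAt (hUo.mem_nhds hx.1)).differentiableAt h0).hasFDerivAt
      exact congr($((ev.hasFDerivAt.comp x h1).fderiv) v)
    obtain ⟨hβ0, hβt⟩ := hγv x hx.1 v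
    generalize fderiv ℝ γ x v = β at hfd hβ0 hβt
    have hβ1 : β 1 = lam (β 1) • N := by
      have hd (s) (hs : s ∈ Icc (0 : ℝ) 1) : HasDerivWithinAt
          (fun s => Q (β (projIcc 0 1 zero_le_one s)) + s • Q v) 0 (Icc 0 1) s := by
        have h1 := Q.hasFDerivAt.comp_hasDerivWithinAt s (hβt ⟨s, hs⟩)
        have h2 := ((hasDerivAt_id s).smul_const (Q v)).hasDerivWithinAt (s := Icc (0 : ℝ) 1)
        exact (h1.add h2).congr_deriv (by simp [hQf])
      have h := eq_of_hasDerivWithinAt_zero hd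
      rw [projIcc_left, projIcc_right] at h
      change Q (β 0) + _ = Q (β 1) + _ at h
      rw [hβ0, zero_smul, one_smul, add_zero, eq_comm, add_eq_right, hQ, sub_eq_zero] at h
      exact h
    have hg := eq_exp_mul_of_hasDerivWithinAt hcP
      (g := fun s => η (γ x (projIcc 0 1 zero_le_one s)) (β (projIcc 0 1 zero_le_one s))) <| by
      intro s hs
      have hproj : projIcc 0 1 zero_le_one s = ⟨s, hs⟩ := projIcc_of_mem zero_le_one hs
      have hγs : HasDerivWithinAt (fun s => γ x (projIcc 0 1 zero_le_one s))
          (f (γ x (projIcc 0 1 zero_le_one s), x)) (Icc 0 1) s := by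
        rw [hproj]
        exact hγt ⟨s, hs⟩
      have hβs : HasDerivWithinAt (fun s => β (projIcc 0 1 zero_le_one s))
          (fderiv ℝ f (γ x (projIcc 0 1 zero_le_one s), x)
          (β (projIcc 0 1 zero_le_one s), v)) (Icc 0 1) s := by
        rw [hproj]
        exact hβt ⟨s, hs⟩
      exact hasDerivWithinAt_apply_of_wedge_eq_zero (hf.differentiable h0 _).hasFDerivAt
        (hηd _) (by filter_upwards [hWo.mem_nhds (hAW x hx _)] with y hy using hηf y hy)
        (hwedge _ (hγB _) N) (hγN _) hγs hβs
    rw [projIcc_left, projIcc_right] at hg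
    change η (γ x 1) (β 1) = _ * η (γ x 0) (β 0) at hg
    rw [hγ0, hβ0, hβ1, map_smul, smul_eq_mul] at hg
    rw [smul_apply, hfd, smul_eq_mul]
    field_simp
    linear_combination -hg
  choose! μ hμ0 hμ using hkey
  exact ⟨A, hAB, hAo, hpA, μ, fun x => ev (γ x), hμ0, hψ, hμ⟩

end

theorem wedge_eq_zero_of_apply_single {n : ℕ} (a : (Fin n → ℝ) →L[ℝ] ℝ)
    (a' : (Fin n → ℝ) →L[ℝ] (Fin n → ℝ) →L[ℝ] ℝ)
    (h : ∀ i j k, a (Pi.single i 1) * (a' (Pi.single j 1) (Pi.single k 1) -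
        a' (Pi.single k 1) (Pi.single j 1)) +
      a (Pi.single j 1) * (a' (Pi.single k 1) (Pi.single i 1) -
        a' (Pi.single i 1) (Pi.single k 1)) +
      a (Pi.single k 1) * (a' (Pi.single i 1) (Pi.single j 1) -
        a' (Pi.single j 1) (Pi.single i 1)) = 0) (u v w : Fin n → ℝ) :
    a u * (a' v w - a' w v) + a v * (a' w u - a' u w) + a w * (a' u v - a' v u) = 0 := by
  have key (u v : Fin n → ℝ) (huv : ∀ k, a u * (a' v (Pi.single k 1) - a' (Pi.single k 1) v) +
      a v * (a' (Pi.single k 1) u - a' u (Pi.single k 1)) +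
      a (Pi.single k 1) * (a' u v - a' v u) = 0) (w : Fin n → ℝ) :
      a u * (a' v w - a' w v) + a v * (a' w u - a' u w) + a w * (a' u v - a' v u) = 0 := by
    let L : (Fin n → ℝ) →L[ℝ] ℝ :=
      a u • (a' v - a'.flip v) + a v • (a'.flip u - a' u) + (a' u v - a' v u) • a
    have hL (w) : L w =
        a u * (a' v w - a' w v) + a v * (a' w u - a' u w) + a w * (a' u v - a' v u) := by
      simp [L, mul_comm (a w)]
    have hL0 : (L : (Fin n → ℝ) →ₗ[ℝ] ℝ) = 0 :=
      LinearMap.pi_ext' fun k => LinearMap.ext_ring <| by simpa [hL] using huv k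
    rw [← hL]
    exact congr($hL0 w)
  refine key u v (fun k => ?_) w
  have h2 := key (Pi.single k 1) u (fun j => ?_) v
  · linear_combination h2
  have h1 := key (Pi.single j 1) (Pi.single k 1) (fun i => h j k i) u
  linear_combination h1

/-- (Clairaut's sufficient condition) If the smooth, nowhere-vanishing coefficient
functions `F i` of a Pfaffian form on an open set `B ⊆ ℝⁿ` satisfy `R_{ijk} = 0`
identically on `B`, then the form is locally integrable on `B`. -/
theorem clairaut_sufficient_condition
    (n : ℕ) (B : Set (Fin n → ℝ)) (hB : IsOpen B)
    (F : Fin n → (Fin n → ℝ) → ℝ)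
    (hF : ∀ i, ContDiffOn ℝ (⊤ : ℕ∞) (F i) B)
    (hF0 : ∀ x ∈ B, (fun i => F i x) ≠ 0)
    (hR : ∀ i j k, ∀ x ∈ B, clairautR F i j k x = 0) :
    ∀ p ∈ B, ∃ A : Set (Fin n → ℝ), A ⊆ B ∧ IsOpen A ∧ p ∈ A ∧ IsIntegrablePfaffOn F A := by
  intro p hp
  have h0 : ((⊤ : ℕ∞) : WithTop ℕ∞) ≠ 0 := by simp
  let η : (Fin n → ℝ) → (Fin n → ℝ) →L[ℝ] ℝ := fun x =>
    ∑ i, F i x • ContinuousLinearMap.proj (R := ℝ) (φ := fun _ : Fin n => ℝ) i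
  have hη : ContDiffOn ℝ (⊤ : ℕ∞) η B :=
    ContDiffOn.sum fun i _ => (hF i).smul contDiffOn_const
  have hηi (x) (i) : η x (Pi.single i 1) = F i x := by
    simp [η, Pi.single_apply]
  have hη' (x) (hx : x ∈ B) (i j) :
      fderiv ℝ η x (Pi.single j 1) (Pi.single i 1) = pd (F i) j x := by
    have h1 := (((hη.contDiffAt (hB.mem_nhds hx)).differentiableAt h0).hasFDerivAt.clm_apply
      (hasFDerivAt_const (Pi.single i 1 : Fin n → ℝ) x)).fderiv
    simp only [hηi] at h1
    rw [pd, h1]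
    simp
  have hηp : η p ≠ 0 := fun h => hF0 p hp <| by
    ext i
    rw [← hηi, h]
    rfl
  obtain ⟨A, hAB, hAo, hpA, μ, ψ, hμ, hψ, h⟩ :=
    exists_eq_smul_fderiv_of_wedge_eq_zero hB hη hp hηp fun x hx u v w =>
      wedge_eq_zero_of_apply_single _ _ (fun i j k => by
        simp only [hηi, hη' x hx]
        exact hR i j k x hx) u v w
  refine ⟨A, hAB, hAo, hpA, μ, ψ, hμ, hψ, fun i x hx => ?_⟩
  rw [← hηi, h x hx]
  rfl
end

section
/- (Forward direction of Carathéodory's theorem) Let B ⊆ ℝⁿ be an open set and let F₁,…,Fₙ : B → ℝ be C^∞ functions with (F₁(x),…,Fₙ(x)) ≠ 0 for every x ∈ B, the coefficient functions of the Pfaffian form δξ = Σᵢ Fᵢ dxᵢ. If δξ is locally integrable on B, then for every point p ∈ B and every open neighborhood M ⊆ B of p there exists a point q ∈ M that is not reachable from p along null curves of δξ contained in M. -/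
open Set

/-- Local integrability on `B`: every point of `B` has an open neighborhood contained
in `B` on which the form is integrable. -/
def IsLocallyIntegrablePfaffOn {n : ℕ} (F : Fin n → (Fin n → ℝ) → ℝ)
    (B : Set (Fin n → ℝ)) : Prop :=
  ∀ p ∈ B, ∃ A : Set (Fin n → ℝ), A ⊆ B ∧ IsOpen A ∧ p ∈ A ∧ IsIntegrablePfaffOn F A

/-- `q` is reachable from `p` along null curves of the Pfaffian form `Σᵢ Fᵢ dxᵢ` contained
in `M`: there is a piecewise-`C¹` curve `γ : [0,1] → M` (continuous on `[0,1]` and `C¹`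
off a finite set `T`) with `γ 0 = p`, `γ 1 = q`, and `Σᵢ Fᵢ(γ t) · γᵢ′(t) = 0` at every
`t ∈ [0,1]` where `γ` is differentiable. -/
def NullReachable {n : ℕ} (F : Fin n → (Fin n → ℝ) → ℝ) (M : Set (Fin n → ℝ))
    (p q : Fin n → ℝ) : Prop :=
  ∃ γ : ℝ → (Fin n → ℝ), ∃ T : Finset ℝ,
    ContinuousOn γ (Icc 0 1) ∧
    (∀ t ∈ Icc (0 : ℝ) 1, γ t ∈ M) ∧
    γ 0 = p ∧ γ 1 = q ∧
    (∀ t ∈ Icc (0 : ℝ) 1, t ∉ T → ContDiffAt ℝ 1 γ t) ∧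
    (∀ t ∈ Icc (0 : ℝ) 1, DifferentiableAt ℝ γ t → ∑ i, F i (γ t) * deriv γ t i = 0)

open Topology Filter

/-- A function which is locally constant along a set `N` takes only countably many values
on `N`. -/
theorem countable_image_of_locally_const {X Y : Type*} [TopologicalSpace X]
    [SecondCountableTopology X] {N : Set X} {g : X → Y}
    (h : ∀ x ∈ N, ∃ W ∈ 𝓝 x, ∀ y ∈ W, y ∈ N → g y = g x) : (g '' N).Countable := by
  choose! W hW hg using h
  obtain ⟨t, htN, htc, hcov⟩ := TopologicalSpace.countable_cover_nhdsWithin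
    (fun x hx => mem_nhdsWithin_of_mem_nhds (hW x hx))
  refine (htc.image g).mono ?_
  rintro _ ⟨y, hy, rfl⟩
  obtain ⟨x, hx, hyx⟩ := mem_iUnion₂.1 (hcov hy)
  exact ⟨x, hx, (hg x (htN hx) y hyx hy).symm⟩

/-- If the derivative of `g` is everywhere a multiple of that of the submersion `f`, then
locally `g` is a function of `f`. -/
theorem exists_nhds_eq_of_fderiv_eq_smul {E : Type*} [NormedAddCommGroup E] [NormedSpace ℝ E]
    [CompleteSpace E] {f g : E → ℝ} {x : E} (hf : ContDiffAt ℝ 1 f x)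
    (hg : ∀ᶠ y in 𝓝 x, DifferentiableAt ℝ g y) (hne : fderiv ℝ f x ≠ 0)
    (h : ∀ᶠ y in 𝓝 x, ∃ c : ℝ, fderiv ℝ g y = c • fderiv ℝ f y) :
    ∃ W ∈ 𝓝 x, ∀ y ∈ W, ∀ z ∈ W, f y = f z → g y = g z := by
  set L := fderiv ℝ f x with hL
  obtain ⟨v, hv⟩ : ∃ v, L v = 1 := by
    obtain ⟨w, hw⟩ : ∃ w, L w ≠ 0 := by
      by_contra! H
      exact hne (ContinuousLinearMap.ext H)
    exact ⟨(L w)⁻¹ • w, by simp [hw]⟩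
  let Φ : E → E := fun y => y + (f y - L y) • v
  have hΦ : ContDiffAt ℝ 1 Φ x :=
    contDiffAt_id.add ((hf.sub L.contDiff.contDiffAt).smul contDiffAt_const)
  have hΦ' : HasFDerivAt Φ ((ContinuousLinearEquiv.refl ℝ E : E ≃L[ℝ] E) : E →L[ℝ] E) x := by
    have h1 := (hasFDerivAt_id (𝕜 := ℝ) x).add
      ((((hf.differentiableAt one_ne_zero).hasFDerivAt).sub (L.hasFDerivAt (x := x))).smul_const v)
    refine h1.congr_fderiv ?_
    ext y
    simp [← hL]
  have hLΦ : ∀ y, L (Φ y) = f y := fun y => by simp [Φ, hv]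
  let e := hΦ.toOpenPartialHomeomorph Φ hΦ' one_ne_zero
  have hxs : x ∈ e.source := hΦ.mem_toOpenPartialHomeomorph_source hΦ' one_ne_zero
  have hcoe : ∀ y, e y = Φ y := fun y => rfl
  have hxt : e x ∈ e.target := e.map_source hxs
  have hsx : e.symm (e x) = x := e.left_inv hxs
  have hsymm : ContDiffAt ℝ 1 e.symm (e x) := by
    refine e.contDiffAt_symm (f₀' := ContinuousLinearEquiv.refl ℝ E) hxt ?_ ?_
    · rw [hsx]; exact hΦ'
    · rw [hsx]; exact hΦ
  have hcont : Tendsto e.symm (𝓝 (e x)) (𝓝 x) := by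
    have := hsymm.continuousAt.tendsto
    rwa [hsx] at this
  have hf1 : ∀ᶠ y in 𝓝 x, DifferentiableAt ℝ f y :=
    (hf.eventually (by simp)).mono fun y hy => hy.differentiableAt one_ne_zero
  have hs1 : ∀ᶠ w in 𝓝 (e x), DifferentiableAt ℝ e.symm w :=
    (hsymm.eventually (by simp)).mono fun y hy => hy.differentiableAt one_ne_zero
  have hgood : ∀ᶠ w in 𝓝 (e x), ∃ c : ℝ, HasFDerivAt (g ∘ e.symm) (c • L) w := by
    have htarget : ∀ᶠ w in 𝓝 (e x), ∀ᶠ w' in 𝓝 w, w' ∈ e.target :=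
      eventually_eventually_nhds.2 (e.open_target.mem_nhds hxt)
    filter_upwards [hcont.eventually hf1, hcont.eventually hg, hcont.eventually h, hs1, htarget]
      with w hfw hgw ⟨c, hc⟩ hsw htw
    refine ⟨c, ?_⟩
    have hfs : HasFDerivAt (f ∘ e.symm) ((fderiv ℝ f (e.symm w)).comp (fderiv ℝ e.symm w)) w :=
      hfw.hasFDerivAt.comp w hsw.hasFDerivAt
    have hfL : HasFDerivAt (f ∘ e.symm) L w := by
      refine L.hasFDerivAt.congr_of_eventuallyEq ?_
      filter_upwards [htw] with w' hw'
      rw [Function.comp_apply, ← hLΦ, ← hcoe, e.right_inv hw']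
    have hgs : HasFDerivAt (g ∘ e.symm) ((fderiv ℝ g (e.symm w)).comp (fderiv ℝ e.symm w)) w :=
      hgw.hasFDerivAt.comp w hsw.hasFDerivAt
    rwa [hc, ContinuousLinearMap.smul_comp, hfs.unique hfL] at hgs
  obtain ⟨r, hr, hball⟩ := Metric.eventually_nhds_iff_ball.1 hgood
  have hconst : ∀ a ∈ Metric.ball (e x) r, ∀ b ∈ Metric.ball (e x) r, L a = L b →
      g (e.symm a) = g (e.symm b) := by
    intro a ha b hb hab
    have hmem : ∀ t ∈ Icc (0 : ℝ) 1, a + t • (b - a) ∈ Metric.ball (e x) r := fun t ht =>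
      (convex_ball (e x) r).add_smul_sub_mem ha hb ht
    have hder : ∀ t ∈ Icc (0 : ℝ) 1,
        HasDerivAt (fun t : ℝ => (g ∘ e.symm) (a + t • (b - a))) 0 t := by
      intro t ht
      obtain ⟨c, hc⟩ := hball _ (hmem t ht)
      have hline : HasDerivAt (fun t : ℝ => a + t • (b - a)) (b - a) t := by
        simpa using ((hasDerivAt_id t).smul_const (b - a)).const_add a
      have hcomp := hc.comp_hasDerivAt t hline
      have hzero : (c • L) (b - a) = 0 := by simp [hab]
      rwa [hzero] at hcomp
    have := constant_of_has_deriv_right_zero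
      (fun t ht => (hder t ht).continuousAt.continuousWithinAt)
      (fun t ht => (hder t (Ico_subset_Icc_self ht)).hasDerivWithinAt) 1 (right_mem_Icc.2 zero_le_one)
    simpa using this.symm
  refine ⟨e.source ∩ e ⁻¹' Metric.ball (e x) r, inter_mem (e.open_source.mem_nhds hxs)
    ((e.continuousAt hxs).preimage_mem_nhds (Metric.ball_mem_nhds _ hr)), ?_⟩
  rintro y ⟨hys, hyb⟩ z ⟨hzs, hzb⟩ hyz
  have := hconst _ hyb _ hzb (by rw [hcoe, hcoe, hLΦ, hLΦ, hyz])
  rwa [e.left_inv hys, e.left_inv hzs] at this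

/-- Given countably many charts `A i` with functions `ψ i` such that each `ψ j` takes countably
many values on each level set of `ψ i`, the saturation of a point under the relation of lying
in a common level set takes only countably many values in each chart. -/
theorem exists_saturated_countable_image {X Y ι : Type*} [Countable ι] {A : ι → Set X}
    {ψ : ι → X → Y} (h : ∀ i j c, (ψ j '' {x | x ∈ A i ∧ x ∈ A j ∧ ψ i x = c}).Countable)
    (p : X) :
    ∃ S : Set X, p ∈ S ∧ (∀ i, ∀ x ∈ A i, ∀ y ∈ A i, ψ i x = ψ i y → x ∈ S → y ∈ S) ∧
      ∀ i, (ψ i '' (S ∩ A i)).Countable := by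
  let next : Set X → Set X := fun S => {y | ∃ i, y ∈ A i ∧ ∃ x ∈ S ∩ A i, ψ i x = ψ i y}
  let s : ℕ → Set X := fun k => next^[k] {p}
  have hs : ∀ k i, (ψ i '' (s k ∩ A i)).Countable := by
    intro k
    induction k with
    | zero =>
      intro i
      exact (((countable_singleton p).mono inter_subset_left).image _)
    | succ k ih =>
      intro j
      have hc : (⋃ i, ⋃ c ∈ ψ i '' (s k ∩ A i),
          ψ j '' {x | x ∈ A i ∧ x ∈ A j ∧ ψ i x = c}).Countable :=
        countable_iUnion fun i => (ih i).biUnion fun c _ => h i j c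
      refine hc.mono ?_
      rintro _ ⟨y, ⟨hy, hyj⟩, rfl⟩
      simp only [s, Function.iterate_succ_apply'] at hy
      obtain ⟨i, hyi, x, hx, hxy⟩ := hy
      exact mem_iUnion.2 ⟨i, mem_iUnion₂.2 ⟨_, ⟨x, hx, rfl⟩, y, ⟨hyi, hyj, hxy.symm⟩, rfl⟩⟩
  refine ⟨⋃ k, s k, mem_iUnion.2 ⟨0, rfl⟩, ?_, ?_⟩
  · intro i x hx y hy hxy hxS
    obtain ⟨k, hk⟩ := mem_iUnion.1 hxS
    refine mem_iUnion.2 ⟨k + 1, ?_⟩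
    simp only [s, Function.iterate_succ_apply']
    exact ⟨i, hy, x, ⟨hk, hx⟩, hxy⟩
  · intro i
    rw [iUnion_inter, image_iUnion]
    exact countable_iUnion fun k => hs k i

/-- The values of a submersion on a neighborhood are uncountable. -/
theorem not_countable_image_of_fderiv_ne_zero {E : Type*} [NormedAddCommGroup E]
    [NormedSpace ℝ E] [CompleteSpace E] {f : E → ℝ} {x : E} (hf : ContDiffAt ℝ 1 f x)
    (hne : fderiv ℝ f x ≠ 0) {U : Set E} (hU : U ∈ 𝓝 x) : ¬ (f '' U).Countable := by
  intro hc
  have hsurj : (fderiv ℝ f x).range = ⊤ := by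
    refine LinearMap.range_eq_top.2 (LinearMap.surjective fun H => hne ?_)
    exact ContinuousLinearMap.coe_injective H
  have hmem : f '' U ∈ 𝓝 (f x) := by
    rw [← (hf.hasStrictFDerivAt one_ne_zero).map_nhds_eq_of_surj hsurj]
    exact image_mem_map hU
  have hempty := interior_eq_empty_iff_dense_compl.2 (hc.dense_compl ℝ)
  exact notMem_empty (f x) (hempty ▸ mem_interior_iff_mem_nhds.2 hmem)

/-- The derivative in direction `v`, expressed through partial derivatives. -/
theorem fderiv_apply_eq_sum_pd {n : ℕ} (f : (Fin n → ℝ) → ℝ) (x v : Fin n → ℝ) :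
    fderiv ℝ f x v = ∑ i, pd f i x * v i := by
  conv_lhs => rw [pi_eq_sum_univ' v, map_sum]
  refine Finset.sum_congr rfl fun i _ => ?_
  rw [map_smul, smul_eq_mul, mul_comm]
  rfl

/-- A continuous function whose derivative vanishes off a finite set is constant. -/
theorem eq_of_hasDerivAt_zero_off_finset {f : ℝ → ℝ} {a b : ℝ} (T : Finset ℝ)
    (hc : ContinuousOn f (uIcc a b)) (hd : ∀ t ∈ uIcc a b, t ∉ T → HasDerivAt f 0 t) :
    f a = f b := by
  have := MeasureTheory.integral_eq_of_hasDerivAt_off_countable f (fun _ => 0)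
    T.countable_toSet hc (fun t ht => hd t (Ioo_subset_Icc_self ht.1) ht.2) (by simp)
  simp only [intervalIntegral.integral_zero] at this
  linarith

/-- A set which is saturated for the level sets of local potentials `ψ i` of the form is
preserved along null curves. -/
theorem NullReachable.mem_of_saturated {n : ℕ} {F : Fin n → (Fin n → ℝ) → ℝ}
    {M S : Set (Fin n → ℝ)} {p q : Fin n → ℝ} (hpq : NullReachable F M p q) {ι : Type*}
    {A : ι → Set (Fin n → ℝ)} {μ ψ : ι → (Fin n → ℝ) → ℝ} (hA : ∀ i, IsOpen (A i))
    (hM : M ⊆ ⋃ i, A i) (hμ : ∀ i, ∀ x ∈ A i, μ i x ≠ 0)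
    (hψ : ∀ i, ∀ x ∈ A i, DifferentiableAt ℝ (ψ i) x)
    (hF : ∀ i j, ∀ x ∈ A i, F j x = μ i x * pd (ψ i) j x)
    (hS : ∀ i, ∀ x ∈ A i, ∀ y ∈ A i, ψ i x = ψ i y → x ∈ S → y ∈ S) (hp : p ∈ S) :
    q ∈ S := by
  obtain ⟨γ, T, hγ, hγM, rfl, rfl, hγT, hγF⟩ := hpq
  refine (isPreconnected_Icc.induction₂ (fun s t => γ s ∈ S ↔ γ t ∈ S) ?_
    (fun _ _ _ _ _ _ => Iff.trans) (fun _ _ _ _ => Iff.symm)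
    (left_mem_Icc.2 zero_le_one) (right_mem_Icc.2 (zero_le_one (α := ℝ)))).1 hp
  intro t ht
  obtain ⟨i, hi⟩ := mem_iUnion.1 (hM (hγM t ht))
  have hnear := (hγ t ht).preimage_mem_nhdsWithin ((hA i).mem_nhds hi)
  obtain ⟨r, hr, hball⟩ := Metric.mem_nhdsWithin_iff.1 hnear
  filter_upwards [inter_mem_nhdsWithin (Icc (0 : ℝ) 1) (Metric.ball_mem_nhds t hr)]
    with s hs
  have hsub : uIcc t s ⊆ Icc 0 1 ∩ Metric.ball t r := by
    rw [← segment_eq_uIcc]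
    exact ((convex_Icc 0 1).inter (convex_ball t r)).segment_subset
      ⟨ht, Metric.mem_ball_self hr⟩ hs
  have hAi : ∀ u ∈ uIcc t s, γ u ∈ A i := fun u hu => hball (hsub hu).symm
  have heq : ψ i (γ t) = ψ i (γ s) := by
    refine eq_of_hasDerivAt_zero_off_finset (f := ψ i ∘ γ) T (fun u hu => ?_) fun u hu huT => ?_
    · exact (hψ i _ (hAi u hu)).continuousAt.comp_continuousWithinAt
        ((hγ u (hsub hu).1).mono fun w hw => (hsub hw).1)
    · have hd := (hγT u (hsub hu).1 huT).differentiableAt one_ne_zero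
      have hnull := hγF u (hsub hu).1 hd
      have hcomp := (hψ i _ (hAi u hu)).hasFDerivAt.comp_hasDerivAt u hd.hasDerivAt
      suffices h0 : fderiv ℝ (ψ i) (γ u) (deriv γ u) = 0 by rwa [h0] at hcomp
      simp only [hF i _ _ (hAi u hu), mul_assoc, ← Finset.mul_sum] at hnull
      rw [fderiv_apply_eq_sum_pd]
      exact (mul_eq_zero.1 hnull).resolve_left (hμ i _ (hAi u hu))
  exact ⟨hS i _ hi _ (hAi s right_mem_uIcc) heq, hS i _ (hAi s right_mem_uIcc) _ hi heq.symm⟩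

/-- (Forward direction of Carathéodory's theorem) If the Pfaffian form with smooth,
nowhere-vanishing coefficients `F i` is locally integrable on the open set `B ⊆ ℝⁿ`,
then every open neighborhood `M ⊆ B` of any point `p ∈ B` contains a point `q`
unreachable from `p` along null curves of the form contained in `M`. -/
theorem caratheodory_forward
    (n : ℕ) (B : Set (Fin n → ℝ)) (hB : IsOpen B)
    (F : Fin n → (Fin n → ℝ) → ℝ)
    (hF : ∀ i, ContDiffOn ℝ (⊤ : ℕ∞) (F i) B)
    (hF0 : ∀ x ∈ B, (fun i => F i x) ≠ 0)
    (hint : IsLocallyIntegrablePfaffOn F B) :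
    ∀ p ∈ B, ∀ M : Set (Fin n → ℝ), M ⊆ B → IsOpen M → p ∈ M →
      ∃ q ∈ M, ¬ NullReachable F M p q := by
  intro p hp M hMB hM hpM
  choose! A hAB hA hpA μ ψ hμ hψ hFψ using hint
  obtain ⟨I, hIB, hI, hcov⟩ := TopologicalSpace.countable_cover_nhdsWithin
    (fun x hx => mem_nhdsWithin_of_mem_nhds ((hA x hx).mem_nhds (hpA x hx)))
  have hψd : ∀ x ∈ B, ∀ y ∈ A x, ContDiffAt ℝ 1 (ψ x) y := fun x hx y hy =>
    ((hψ x hx).contDiffAt ((hA x hx).mem_nhds hy)).of_le (by exact_mod_cast le_top)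
  have hne : ∀ x ∈ B, ∀ y ∈ A x, fderiv ℝ (ψ x) y ≠ 0 := by
    intro x hx y hy h0
    refine hF0 y (hAB x hx hy) (funext fun i => ?_)
    rw [hFψ x hx i y hy, pd, h0]
    simp
  have hprop : ∀ x ∈ B, ∀ z ∈ B, ∀ y ∈ A x ∩ A z,
      ∃ c : ℝ, fderiv ℝ (ψ z) y = c • fderiv ℝ (ψ x) y := by
    intro x hx z hz y hy
    refine ⟨(μ z y)⁻¹ * μ x y, ContinuousLinearMap.ext fun v => ?_⟩
    rw [smul_apply, fderiv_apply_eq_sum_pd, fderiv_apply_eq_sum_pd,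
      smul_eq_mul, Finset.mul_sum]
    refine Finset.sum_congr rfl fun i _ => ?_
    have h1 := hFψ x hx i y hy.1
    rw [hFψ z hz i y hy.2] at h1
    have := hμ z hz y hy.2
    field_simp
    linear_combination v i * h1
  have hcross : ∀ x z : I, ∀ c,
      (ψ z '' {y | y ∈ A x ∧ y ∈ A z ∧ ψ x y = c}).Countable := by
    intro x z c
    have hx := hIB x.2
    have hz := hIB z.2
    refine countable_image_of_locally_const ?_
    rintro y ⟨hyx, hyz, hyc⟩
    have hnhds : A x ∩ A z ∈ 𝓝 y := ((hA x hx).inter (hA z hz)).mem_nhds ⟨hyx, hyz⟩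
    obtain ⟨W, hW, hconst⟩ := exists_nhds_eq_of_fderiv_eq_smul (hψd x hx y hyx)
      (g := ψ z) (by
        filter_upwards [hnhds] with w hw
        exact (hψd z hz w hw.2).differentiableAt one_ne_zero)
      (hne x hx y hyx) (by
        filter_upwards [hnhds] with w hw
        exact hprop x hx z hz w hw)
    exact ⟨W, hW, fun w hw hwN => hconst w hw y (mem_of_mem_nhds hW) (hwN.2.2.trans hyc.symm)⟩
  have : Countable I := hI.to_subtype
  obtain ⟨S, hpS, hsat, hcount⟩ := exists_saturated_countable_image
    (A := fun x : I => A x) (ψ := fun x : I => ψ x) hcross p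
  obtain ⟨x, hx, hpx⟩ := mem_iUnion₂.1 (hcov hp)
  have hunc := not_countable_image_of_fderiv_ne_zero (hψd x (hIB hx) p hpx)
    (hne x (hIB hx) p hpx) (((hA x (hIB hx)).inter hM).mem_nhds ⟨hpx, hpM⟩)
  by_contra! hall
  refine hunc ((hcount ⟨x, hx⟩).mono (image_mono ?_))
  intro q hq
  refine ⟨?_, hq.1⟩
  refine (hall q hq.2).mem_of_saturated (fun i : I => hA i (hIB i.2))
    (fun y hy => ?_) (fun i => hμ i (hIB i.2))
    (fun i y hy => (hψd i (hIB i.2) y hy).differentiableAt one_ne_zero)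
    (fun i j => hFψ i (hIB i.2) j) hsat hpS
  obtain ⟨z, hz, hyz⟩ := mem_iUnion₂.1 (hcov (hMB hy))
  exact mem_iUnion.2 ⟨⟨z, hz⟩, hyz⟩
end

section
/- (Key step in the converse of Carathéodory's theorem) Let B ⊆ ℝⁿ be an open set and let F₁,…,Fₙ : B → ℝ be C^∞ functions with (F₁(x),…,Fₙ(x)) ≠ 0 for every x ∈ B, the coefficient functions of the Pfaffian form δξ = Σᵢ Fᵢ dxᵢ. Suppose that for every point p ∈ B and every open neighborhood M ⊆ B of p there exists a point q ∈ M not reachable from p along null curves of δξ contained in M. Then R_{ijk} = 0 identically on B for all indices i, j, k. -/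
open Set

open Filter Topology Metric Asymptotics

/-- A `C¹` vector field has a local flow near `x₀`, jointly continuous in the initial point and
time, which stays in any prescribed neighbourhood of `x₀`. -/
theorem exists_local_flow {E : Type*} [NormedAddCommGroup E] [NormedSpace ℝ E] [CompleteSpace E]
    {X : E → E} {x₀ : E} (hX : ContDiffAt ℝ 1 X x₀) {U : Set E} (hU : U ∈ 𝓝 x₀) :
    ∃ φ : E × ℝ → E, ∃ r > 0, ∀ x ∈ ball x₀ r, φ (x, 0) = x ∧
      ∀ t ∈ ball (0 : ℝ) r, φ (x, t) ∈ U ∧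
        HasDerivAt (fun τ => φ (x, τ)) (X (φ (x, t))) t ∧ ContinuousAt φ (x, t) := by
  obtain ⟨ε, hε, a, ρ, L, K, hρ, hpl⟩ := IsPicardLindelof.of_contDiffAt_one hX
  obtain ⟨φ, hφ, hcont⟩ := (hpl 0).exists_forall_mem_closedBall_eq_hasDerivWithinAt_continuousOn
  simp only [zero_sub, zero_add] at hφ hcont
  have hcontAt : ∀ x ∈ ball x₀ (ρ : ℝ), ∀ t ∈ ball (0 : ℝ) ε, ContinuousAt φ (x, t) := by
    intro x hx t ht
    rw [Real.ball_eq_Ioo, zero_sub, zero_add] at ht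
    exact hcont.continuousAt (prod_mem_nhds
      (mem_of_superset (isOpen_ball.mem_nhds hx) ball_subset_closedBall)
      (Icc_mem_nhds ht.1 ht.2))
  have hx₀ : φ (x₀, 0) = x₀ := (hφ x₀ (mem_closedBall_self ρ.2)).1
  have hmem : ∀ᶠ z in 𝓝 (x₀, (0 : ℝ)), φ z ∈ U := by
    refine (hcontAt x₀ (mem_ball_self hρ) 0 (mem_ball_self hε)).eventually_mem ?_
    rwa [hx₀]
  obtain ⟨δ, hδ, hδU⟩ := Metric.eventually_nhds_iff_ball.mp hmem
  refine ⟨φ, min δ (min ρ ε), by positivity, fun x hx => ?_⟩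
  have hx' : x ∈ ball x₀ (ρ : ℝ) :=
    ball_subset_ball ((min_le_right _ _).trans (min_le_left _ _)) hx
  refine ⟨(hφ x (ball_subset_closedBall hx')).1, fun t ht => ?_⟩
  have ht' : t ∈ ball (0 : ℝ) ε :=
    ball_subset_ball ((min_le_right _ _).trans (min_le_right _ _)) ht
  refine ⟨hδU (x, t) ?_, ?_, hcontAt x hx' t ht'⟩
  · rw [← ball_prod_same]
    exact ⟨ball_subset_ball (min_le_left _ _) hx, ball_subset_ball (min_le_left _ _) ht⟩
  · rw [Real.ball_eq_Ioo, zero_sub, zero_add] at ht'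
    exact ((hφ x (ball_subset_closedBall hx')).2 t (Ioo_subset_Icc_self ht')).hasDerivAt
      (Icc_mem_nhds ht'.1 ht'.2)

/-- Second-order expansion of the time-`s` flow started from a point that itself depends on `s`
with a known second-order expansion. -/
theorem flow_isLittleO_sq {E : Type*} [NormedAddCommGroup E] [NormedSpace ℝ E]
    {X : E → E} {L : E →L[ℝ] E} {x₀ : E} (hL : HasFDerivAt X L x₀)
    {φ : E × ℝ → E} {r : ℝ} (hr : 0 < r) (hφ : ∀ x ∈ ball x₀ r, φ (x, 0) = x ∧
      ∀ t ∈ ball (0 : ℝ) r, HasDerivAt (fun τ => φ (x, τ)) (X (φ (x, t))) t)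
    (hcont : ContinuousAt φ (x₀, 0))
    {ψ : ℝ → E} {v a : E} (hψ₀ : Tendsto ψ (𝓝[>] 0) (𝓝 x₀))
    (hψ : (fun s => ψ s - x₀ - s • v - s ^ 2 • a) =o[𝓝[>] 0] fun s : ℝ => s ^ 2) :
    (fun s => φ (ψ s, s) - x₀ - s • (v + X x₀) - s ^ 2 • (a + L v + (1 / 2 : ℝ) • L (X x₀)))
      =o[𝓝[>] 0] fun s : ℝ => s ^ 2 := by
  have hid : Tendsto (fun s : ℝ => s) (𝓝[>] 0) (𝓝 0) := tendsto_id.mono_left nhdsWithin_le_nhds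
  have hsq : (fun s : ℝ => s ^ 2) =o[𝓝[>] 0] fun s : ℝ => s := by
    simpa [sq] using (isLittleO_one_iff ℝ |>.mpr hid).mul_isBigO (isBigO_refl (fun s : ℝ => s) _)
  have hψ1 : (fun s => ψ s - x₀ - s • v) =o[𝓝[>] 0] fun s : ℝ => s := by
    have h2 : (fun s : ℝ => s ^ 2 • a) =o[𝓝[>] 0] fun s : ℝ => s :=
      (IsBigO.of_bound ‖a‖ (Eventually.of_forall fun s => by
        rw [norm_smul, mul_comm])).trans_isLittleO hsq
    simpa using (hψ.trans hsq).add h2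
  refine isLittleO_iff.mpr fun c hc => ?_
  set K : ℝ := 2 + ‖v‖ + ‖X x₀‖ + 2 * ‖L‖ with hK
  have hKpos : 0 < K := by positivity
  set c₁ : ℝ := min 1 (c / 2 / K) with hc₁
  have hc₁pos : 0 < c₁ := by positivity
  have hc₁1 : c₁ ≤ 1 := min_le_left _ _
  have hc₁K : c₁ * K ≤ c / 2 := by
    rw [← le_div_iff₀ hKpos]; exact min_le_right _ _
  have hx₀ : φ (x₀, 0) = x₀ := (hφ x₀ (mem_ball_self hr)).1
  have hnear : ∀ᶠ y in 𝓝 x₀, ‖X y - X x₀ - L (y - x₀)‖ ≤ c₁ * ‖y - x₀‖ ∧ ‖X y - X x₀‖ ≤ c₁ := by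
    refine ((isLittleO_iff.mp hL.isLittleO) hc₁pos).and ?_
    have := (Metric.continuousAt_iff'.mp hL.continuousAt) c₁ hc₁pos
    filter_upwards [this] with y hy
    rw [← dist_eq_norm]; exact hy.le
  have hnear' : ∀ᶠ z in 𝓝 (x₀, (0 : ℝ)), ‖X (φ z) - X x₀ - L (φ z - x₀)‖ ≤ c₁ * ‖φ z - x₀‖ ∧
      ‖X (φ z) - X x₀‖ ≤ c₁ := by
    rw [ContinuousAt, hx₀] at hcont
    exact hcont.eventually hnear
  obtain ⟨δ, hδ, hδφ⟩ := Metric.eventually_nhds_iff_ball.mp hnear'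
  have hρ : 0 < min δ r := lt_min hδ hr
  filter_upwards [isLittleO_iff.mp hψ (half_pos hc), isLittleO_iff.mp hψ1 hc₁pos,
    hψ₀ (ball_mem_nhds x₀ hρ), hid (ball_mem_nhds 0 hρ), self_mem_nhdsWithin]
    with s hs2 hs1 hsx hs0 hspos
  replace hspos : 0 < s := hspos
  have hsr : ψ s ∈ ball x₀ r := ball_subset_ball (min_le_right _ _) hsx
  have hmem : ∀ t ∈ Icc 0 s, t ∈ ball (0 : ℝ) (min δ r) := by
    intro t ht
    rw [Real.ball_eq_Ioo] at hs0
    rw [Real.ball_eq_Ioo]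
    exact ⟨by linarith [ht.1], ht.2.trans_lt hs0.2⟩
  have hn : ∀ t ∈ Icc 0 s, ‖X (φ (ψ s, t)) - X x₀ - L (φ (ψ s, t) - x₀)‖
      ≤ c₁ * ‖φ (ψ s, t) - x₀‖ ∧ ‖X (φ (ψ s, t)) - X x₀‖ ≤ c₁ := by
    intro t ht
    apply hδφ (ψ s, t)
    rw [← ball_prod_same]
    exact ⟨ball_subset_ball (min_le_left _ _) hsx, ball_subset_ball (min_le_left _ _) (hmem t ht)⟩
  have hd : ∀ t ∈ Icc 0 s, HasDerivAt (fun τ => φ (ψ s, τ)) (X (φ (ψ s, t))) t := fun t ht =>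
    (hφ (ψ s) hsr).2 t (ball_subset_ball (min_le_right _ _) (hmem t ht))
  have h0 : φ (ψ s, 0) = ψ s := (hφ (ψ s) hsr).1
  have hfirst : ∀ t ∈ Icc 0 s, ‖φ (ψ s, t) - t • X x₀ - ψ s‖ ≤ c₁ * t := by
    intro t ht
    have := norm_image_sub_le_of_norm_deriv_le_segment' (a := 0) (b := s) (C := c₁)
      (f := fun τ => φ (ψ s, τ) - τ • X x₀) (f' := fun τ => X (φ (ψ s, τ)) - X x₀)
      (fun τ hτ => by
        simpa using ((hd τ hτ).fun_sub ((hasDerivAt_id τ).smul_const (X x₀))).hasDerivWithinAt)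
      (fun τ hτ => (hn τ (Ico_subset_Icc_self hτ)).2) t ht
    simpa [h0] using this
  have hdev : ∀ t ∈ Icc 0 s, ‖φ (ψ s, t) - x₀ - (s • v + t • X x₀)‖ ≤ 2 * c₁ * s := by
    intro t ht
    rw [Real.norm_of_nonneg hspos.le] at hs1
    calc ‖φ (ψ s, t) - x₀ - (s • v + t • X x₀)‖
        = ‖(φ (ψ s, t) - t • X x₀ - ψ s) + (ψ s - x₀ - s • v)‖ := by congr 1; abel
      _ ≤ c₁ * t + c₁ * s := (norm_add_le _ _).trans (add_le_add (hfirst t ht) hs1)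
      _ ≤ 2 * c₁ * s := by nlinarith [ht.2]
  have hdist : ∀ t ∈ Icc 0 s, ‖φ (ψ s, t) - x₀‖ ≤ (2 + ‖v‖ + ‖X x₀‖) * s := by
    intro t ht
    calc ‖φ (ψ s, t) - x₀‖
        = ‖(φ (ψ s, t) - x₀ - (s • v + t • X x₀)) + (s • v + t • X x₀)‖ := by congr 1; abel
      _ ≤ 2 * c₁ * s + (s * ‖v‖ + t * ‖X x₀‖) := by
        refine (norm_add_le _ _).trans (add_le_add (hdev t ht) ((norm_add_le _ _).trans ?_))
        rw [norm_smul, norm_smul, Real.norm_of_nonneg hspos.le, Real.norm_of_nonneg ht.1]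
      _ ≤ (2 + ‖v‖ + ‖X x₀‖) * s := by
        nlinarith [mul_le_mul_of_nonneg_right ht.2 (norm_nonneg (X x₀)),
          mul_le_mul_of_nonneg_right hc₁1 hspos.le]
  have hsecond := norm_image_sub_le_of_norm_deriv_le_segment' (a := 0) (b := s) (C := c₁ * K * s)
    (f := fun τ => φ (ψ s, τ) - τ • X x₀ - (τ * s) • L v - (τ ^ 2 / 2) • L (X x₀))
    (f' := fun τ => X (φ (ψ s, τ)) - X x₀ - s • L v - τ • L (X x₀))
    (fun τ hτ => by
      have h1 := (hd τ hτ).fun_sub ((hasDerivAt_id τ).smul_const (X x₀))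
      have h2 := h1.fun_sub (((hasDerivAt_id τ).mul_const s).smul_const (L v))
      have h3 := h2.fun_sub ((((hasDerivAt_id τ).fun_pow 2).div_const 2).smul_const (L (X x₀)))
      simpa using h3.hasDerivWithinAt)
    (fun τ hτ => by
      have hτ' := Ico_subset_Icc_self hτ
      calc ‖X (φ (ψ s, τ)) - X x₀ - s • L v - τ • L (X x₀)‖
          = ‖(X (φ (ψ s, τ)) - X x₀ - L (φ (ψ s, τ) - x₀)) +
              L (φ (ψ s, τ) - x₀ - (s • v + τ • X x₀))‖ := by
            congr 1
            simp only [map_sub, map_add, map_smul]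
            abel
        _ ≤ c₁ * ((2 + ‖v‖ + ‖X x₀‖) * s) + ‖L‖ * (2 * c₁ * s) := by
            refine (norm_add_le _ _).trans (add_le_add ?_ ?_)
            · exact (hn τ hτ').1.trans (mul_le_mul_of_nonneg_left (hdist τ hτ') hc₁pos.le)
            · exact (L.le_opNorm _).trans
                (mul_le_mul_of_nonneg_left (hdev τ hτ') (norm_nonneg _))
        _ = c₁ * K * s := by rw [hK]; ring)
    s (right_mem_Icc.mpr hspos.le)
  simp only [h0, sub_zero, zero_smul, zero_mul, ne_eq, OfNat.ofNat_ne_zero, not_false_eq_true,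
    zero_pow, zero_div] at hsecond
  rw [Real.norm_of_nonneg (sq_nonneg s)] at hs2 ⊢
  calc ‖φ (ψ s, s) - x₀ - s • (v + X x₀) - s ^ 2 • (a + L v + (1 / 2 : ℝ) • L (X x₀))‖
      = ‖(φ (ψ s, s) - s • X x₀ - (s * s) • L v - (s ^ 2 / 2) • L (X x₀) - ψ s) +
          (ψ s - x₀ - s • v - s ^ 2 • a)‖ := by congr 1; module
    _ ≤ c₁ * K * s * s + c / 2 * s ^ 2 := (norm_add_le _ _).trans (add_le_add hsecond hs2)
    _ ≤ c * s ^ 2 := by nlinarith [mul_le_mul_of_nonneg_right hc₁K (sq_nonneg s)]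

/-- `q` is joined to `p` inside `M` by a globally `C¹` null curve that rests at `p` before time `0`
and at `q` after time `1`. -/
def RestingNullReachable {n : ℕ} (F : Fin n → (Fin n → ℝ) → ℝ) (M : Set (Fin n → ℝ))
    (p q : Fin n → ℝ) : Prop :=
  ∃ γ : ℝ → (Fin n → ℝ), ContDiff ℝ 1 γ ∧ (∀ t ≤ 0, γ t = p) ∧ (∀ t, 1 ≤ t → γ t = q) ∧
    ∀ t, γ t ∈ M ∧ ∑ i, F i (γ t) * deriv γ t i = 0

namespace RestingNullReachable

variable {n : ℕ} {F : Fin n → (Fin n → ℝ) → ℝ} {M : Set (Fin n → ℝ)} {p q z : Fin n → ℝ}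

theorem nullReachable (h : RestingNullReachable F M p q) : NullReachable F M p q := by
  obtain ⟨γ, hγ, h0, h1, hM⟩ := h
  exact ⟨γ, ∅, hγ.continuous.continuousOn, fun t _ => (hM t).1, h0 0 le_rfl, h1 1 le_rfl,
    fun t _ _ => hγ.contDiffAt, fun t _ _ => (hM t).2⟩

theorem refl (hp : p ∈ M) : RestingNullReachable F M p p :=
  ⟨fun _ => p, contDiff_const, fun _ _ => rfl, fun _ _ => rfl, fun _ => ⟨hp, by simp⟩⟩

theorem symm (h : RestingNullReachable F M p q) : RestingNullReachable F M q p := by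
  obtain ⟨γ, hγ, h0, h1, hM⟩ := h
  refine ⟨fun t => γ (1 - t), hγ.comp (contDiff_const.sub contDiff_id),
    fun t ht => h1 _ (by linarith), fun t ht => h0 _ (by linarith), fun t => ⟨(hM _).1, ?_⟩⟩
  rw [deriv_comp_const_sub]
  simpa using (hM (1 - t)).2

theorem trans (h : RestingNullReachable F M p q) (h' : RestingNullReachable F M q z) :
    RestingNullReachable F M p z := by
  obtain ⟨γ, hγ, h0, h1, hM⟩ := h
  obtain ⟨η, hη, k0, k1, kM⟩ := h'
  set ζ : ℝ → (Fin n → ℝ) := fun t => γ (2 * t) + η (2 * t - 1) - q with hζ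
  have hder : ∀ t, HasDerivAt ζ ((2 : ℝ) • deriv γ (2 * t) + (2 : ℝ) • deriv η (2 * t - 1)) t := by
    intro t
    have e1 : HasDerivAt (fun t : ℝ => 2 * t) 2 t := by
      simpa using (hasDerivAt_id t).const_mul (2 : ℝ)
    have a1 := ((hγ.differentiable one_ne_zero (2 * t)).hasDerivAt).scomp t e1
    have a2 := ((hη.differentiable one_ne_zero (2 * t - 1)).hasDerivAt).scomp t (e1.sub_const 1)
    exact (a1.add a2).sub_const q
  have dη : ∀ t ≤ 0, deriv η t = 0 := by
    intro t ht
    have hw : HasDerivWithinAt η 0 (Iic t) t :=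
      (hasDerivWithinAt_const t (Iic t) q).congr (fun s hs => k0 s (le_trans hs ht)) (k0 t ht)
    exact (uniqueDiffWithinAt_Iic t).eq_deriv _
      ((hη.differentiable one_ne_zero t).hasDerivAt.hasDerivWithinAt) hw
  have dγ : ∀ t, 1 ≤ t → deriv γ t = 0 := by
    intro t ht
    have hw : HasDerivWithinAt γ 0 (Ici t) t :=
      (hasDerivWithinAt_const t (Ici t) q).congr (fun s hs => h1 s (le_trans ht hs)) (h1 t ht)
    exact (uniqueDiffWithinAt_Ici t).eq_deriv _
      ((hγ.differentiable one_ne_zero t).hasDerivAt.hasDerivWithinAt) hw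
  refine ⟨ζ, ?_, fun t ht => ?_, fun t ht => ?_, fun t => ?_⟩
  · exact ((hγ.comp (contDiff_const.mul contDiff_id)).add
      (hη.comp ((contDiff_const.mul contDiff_id).sub contDiff_const))).sub contDiff_const
  · simp [hζ, h0 (2 * t) (by linarith), k0 (2 * t - 1) (by linarith)]
  · simp [hζ, h1 (2 * t) (by linarith), k1 (2 * t - 1) (by linarith)]
  · rw [(hder t).deriv]
    rcases le_total (2 * t) 1 with ht | ht
    · have hz : ζ t = γ (2 * t) := by simp [hζ, k0 (2 * t - 1) (by linarith)]
      rw [hz, dη _ (by linarith)]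
      refine ⟨(hM _).1, ?_⟩
      have := (hM (2 * t)).2
      simp only [smul_zero, add_zero, Pi.smul_apply, smul_eq_mul, mul_left_comm _ (2 : ℝ),
        ← Finset.mul_sum, this, mul_zero]
    · have hz : ζ t = η (2 * t - 1) := by simp [hζ, h1 (2 * t) ht]
      rw [hz, dγ _ ht]
      refine ⟨(kM _).1, ?_⟩
      have := (kM (2 * t - 1)).2
      simp only [smul_zero, zero_add, Pi.smul_apply, smul_eq_mul, mul_left_comm _ (2 : ℝ),
        ← Finset.mul_sum, this, mul_zero]

/-- Points on an integral curve of a null vector field are reachable from its starting point. -/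
theorem of_integralCurve {X : (Fin n → ℝ) → (Fin n → ℝ)} (hX : ContinuousOn X M)
    (hnull : ∀ x ∈ M, ∑ i, F i x * X x i = 0) {r s : ℝ} (hs : s ∈ ball (0 : ℝ) r)
    {g : ℝ → (Fin n → ℝ)}
    (hg : ∀ t ∈ ball (0 : ℝ) r, g t ∈ M ∧ HasDerivAt g (X (g t)) t) :
    RestingNullReachable F M (g 0) (g s) := by
  set σ := Real.smoothTransition
  have hσ : ContDiff ℝ 1 σ := Real.smoothTransition.contDiff (n := 1)
  have hmem : ∀ t, s * σ t ∈ ball (0 : ℝ) r := by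
    intro t
    rw [mem_ball_zero_iff] at hs ⊢
    rw [norm_mul, Real.norm_of_nonneg (Real.smoothTransition.nonneg t)]
    exact (mul_le_of_le_one_right (norm_nonneg s) (Real.smoothTransition.le_one t)).trans_lt hs
  have hder : ∀ t, HasDerivAt (fun t => g (s * σ t)) ((s * deriv σ t) • X (g (s * σ t))) t :=
    fun t => (hg _ (hmem t)).2.scomp t
      (((hσ.differentiable one_ne_zero t).hasDerivAt).const_mul s)
  have hcont : Continuous fun t => g (s * σ t) :=
    continuous_iff_continuousAt.mpr fun t => (hder t).continuousAt
  refine ⟨fun t => g (s * σ t), ?_, fun t ht => ?_, fun t ht => ?_, fun t => ?_⟩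
  · rw [contDiff_one_iff_deriv]
    refine ⟨fun t => (hder t).differentiableAt, ?_⟩
    rw [funext fun t => (hder t).deriv]
    exact (continuous_const.mul (hσ.continuous_deriv le_rfl)).smul
      (hX.comp_continuous hcont fun t => (hg _ (hmem t)).1)
  · simp [σ, Real.smoothTransition.zero_of_nonpos ht]
  · simp [σ, Real.smoothTransition.one_of_one_le ht]
  · refine ⟨(hg _ (hmem t)).1, ?_⟩
    rw [(hder t).deriv]
    simp only [Pi.smul_apply, smul_eq_mul, mul_left_comm _ (s * deriv σ t), ← Finset.mul_sum,
      hnull _ (hg _ (hmem t)).1, mul_zero]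

end RestingNullReachable

/-- The projection of the constant field `w` along the `k`-th coordinate axis onto the kernel of
the Pfaffian form `Σᵢ Fᵢ dxᵢ`. -/
noncomputable def horizontalField {n : ℕ} (F : Fin n → (Fin n → ℝ) → ℝ) (k : Fin n)
    (w x : Fin n → ℝ) : Fin n → ℝ :=
  w - ((∑ i, F i x * w i) / F k x) • Pi.single k 1

/-- `ψ s` is reachable from `x₀` for small `s`, moves with constant velocity `v` in the coordinates
other than the `k`-th one, and equals `x₀ + s v + s² a` up to `o(s²)` as `s → 0⁺`. -/
structure HorizontalEndpoint {n : ℕ} (F : Fin n → (Fin n → ℝ) → ℝ) (M : Set (Fin n → ℝ))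
    (k : Fin n) (x₀ : Fin n → ℝ) (ψ : ℝ → (Fin n → ℝ)) (v a : Fin n → ℝ) : Prop where
  zero : ψ 0 = x₀
  nearby : ∀ᶠ s in 𝓝 0, ContinuousAt ψ s ∧ RestingNullReachable F M x₀ (ψ s) ∧
    ∀ m ≠ k, ψ s m = x₀ m + s * v m
  expansion : (fun s => ψ s - x₀ - s • v - s ^ 2 • a) =o[𝓝[>] 0] fun s : ℝ => s ^ 2

section

variable {n : ℕ} {F : Fin n → (Fin n → ℝ) → ℝ} {M : Set (Fin n → ℝ)} {k : Fin n}
  {x₀ : Fin n → ℝ}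

theorem sum_mul_horizontalField (w : Fin n → ℝ) {x : Fin n → ℝ} (hk : F k x ≠ 0) :
    ∑ i, F i x * horizontalField F k w x i = 0 := by
  simp only [horizontalField, Pi.sub_apply, Pi.smul_apply, smul_eq_mul, mul_sub,
    Finset.sum_sub_distrib, Pi.single_apply, mul_ite, mul_one, mul_zero, Finset.sum_ite_eq',
    Finset.mem_univ, if_true]
  field_simp
  ring

theorem horizontalField_apply_of_ne (w x : Fin n → ℝ) {m : Fin n} (hm : m ≠ k) :
    horizontalField F k w x m = w m := by
  simp [horizontalField, hm]

theorem horizontalField_neg (w : Fin n → ℝ) :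
    horizontalField F k (-w) = -horizontalField F k w := by
  ext x m
  simp [horizontalField, neg_div]
  ring

theorem contDiffOn_horizontalField (hF : ∀ i, ContDiffOn ℝ 1 (F i) M)
    (hk : ∀ x ∈ M, F k x ≠ 0) (w : Fin n → ℝ) : ContDiffOn ℝ 1 (horizontalField F k w) M :=
  contDiffOn_const.sub (((ContDiffOn.sum fun i _ => (hF i).mul contDiffOn_const).div
    (hF k) hk).smul contDiffOn_const)

theorem exists_horizontal_flow (hM : IsOpen M) (hF : ∀ i, ContDiffOn ℝ 1 (F i) M)
    (hk : ∀ x ∈ M, F k x ≠ 0) (hx₀ : x₀ ∈ M) (w : Fin n → ℝ) :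
    ∃ φ : (Fin n → ℝ) × ℝ → (Fin n → ℝ), ∃ r > 0, ∀ x ∈ ball x₀ r, φ (x, 0) = x ∧
      ∀ t ∈ ball (0 : ℝ) r,
        HasDerivAt (fun τ => φ (x, τ)) (horizontalField F k w (φ (x, t))) t ∧
        ContinuousAt φ (x, t) ∧ RestingNullReachable F M x (φ (x, t)) ∧
        ∀ m ≠ k, φ (x, t) m = x m + t * w m := by
  have hX := contDiffOn_horizontalField hF hk w
  obtain ⟨φ, r, hr, hφ⟩ := exists_local_flow (hX.contDiffAt (hM.mem_nhds hx₀)) (hM.mem_nhds hx₀)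
  refine ⟨φ, r, hr, fun x hx => ⟨(hφ x hx).1, fun t ht => ?_⟩⟩
  obtain ⟨h0, h⟩ := hφ x hx
  refine ⟨(h t ht).2.1, (h t ht).2.2, ?_, fun m hm => ?_⟩
  · have := RestingNullReachable.of_integralCurve hX.continuousOn
      (fun y hy => sum_mul_horizontalField w (hk y hy)) ht fun τ hτ => ⟨(h τ hτ).1, (h τ hτ).2.1⟩
    rwa [h0] at this
  · have hd : ∀ τ ∈ ball (0 : ℝ) r, HasDerivAt (fun τ => φ (x, τ) m - τ * w m) 0 τ := by
      intro τ hτ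
      have h1 := (hasDerivAt_pi.mp (h τ hτ).2.1 m).fun_sub ((hasDerivAt_id τ).mul_const (w m))
      simpa [horizontalField_apply_of_ne w _ hm] using h1
    have := isOpen_ball.is_const_of_deriv_eq_zero (convex_ball (0 : ℝ) r).isPreconnected
      (fun τ hτ => (hd τ hτ).differentiableAt.differentiableWithinAt) (fun τ hτ => (hd τ hτ).deriv)
      ht (mem_ball_self hr)
    simp only [h0, zero_mul, sub_zero] at this
    linarith

theorem HorizontalEndpoint.refl (hx₀ : x₀ ∈ M) :
    HorizontalEndpoint F M k x₀ (fun _ => x₀) 0 0 where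
  zero := rfl
  nearby := Eventually.of_forall fun s =>
    ⟨continuousAt_const, .refl hx₀, fun m _ => by simp⟩
  expansion := by simp

theorem HorizontalEndpoint.append_flow (hM : IsOpen M) (hF : ∀ i, ContDiffOn ℝ 1 (F i) M)
    (hk : ∀ x ∈ M, F k x ≠ 0) (hx₀ : x₀ ∈ M) {ψ : ℝ → (Fin n → ℝ)} {v a : Fin n → ℝ}
    (hψ : HorizontalEndpoint F M k x₀ ψ v a) (w : Fin n → ℝ)
    {L : (Fin n → ℝ) →L[ℝ] (Fin n → ℝ)} (hL : HasFDerivAt (horizontalField F k w) L x₀) :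
    ∃ ψ', HorizontalEndpoint F M k x₀ ψ' (v + horizontalField F k w x₀)
      (a + L v + (1 / 2 : ℝ) • L (horizontalField F k w x₀)) := by
  obtain ⟨φ, r, hr, hφ⟩ := exists_horizontal_flow hM hF hk hx₀ w
  have hψ₀ : Tendsto ψ (𝓝 0) (𝓝 x₀) := by
    have := hψ.nearby.self_of_nhds.1
    rwa [ContinuousAt, hψ.zero] at this
  refine ⟨fun s => φ (ψ s, s), ?_, ?_, ?_⟩
  · simp [hψ.zero, (hφ x₀ (mem_ball_self hr)).1]
  · filter_upwards [hψ.nearby, hψ₀ (ball_mem_nhds x₀ hr), ball_mem_nhds (0 : ℝ) hr]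
      with s ⟨hc, hreach, hcoord⟩ hball hs
    obtain ⟨-, hc', hreach', hcoord'⟩ := (hφ (ψ s) hball).2 s hs
    refine ⟨hc'.comp₂ hc continuousAt_id, hreach.trans hreach', fun m hm => ?_⟩
    simp only [hcoord' m hm, hcoord m hm, Pi.add_apply, horizontalField_apply_of_ne w x₀ hm]
    ring
  · exact flow_isLittleO_sq hL hr (fun x hx => ⟨(hφ x hx).1, fun t ht => ((hφ x hx).2 t ht).1⟩)
      ((hφ x₀ (mem_ball_self hr)).2 0 (mem_ball_self hr)).2.1
      (hψ₀.mono_left nhdsWithin_le_nhds) hψ.expansion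

/-- Running round a small commutator loop of horizontal fields changes only the `k`-th coordinate,
and does so to second order at the rate `-R_{ijk} / F_k²`. -/
theorem exists_vertical_displacement (hM : IsOpen M) (hF : ∀ i, ContDiffOn ℝ 1 (F i) M)
    (hk : ∀ x ∈ M, F k x ≠ 0) (hx₀ : x₀ ∈ M) (i j : Fin n) :
    ∃ e : ℝ → ℝ, e 0 = 0 ∧ (∀ᶠ s in 𝓝 0, ContinuousAt e s ∧
      RestingNullReachable F M x₀ (x₀ + e s • Pi.single k 1)) ∧
      (fun s => e s - s ^ 2 * (-clairautR F i j k x₀ / F k x₀ ^ 2)) =o[𝓝[>] 0]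
        fun s : ℝ => s ^ 2 := by
  have hk₀ := hk x₀ hx₀
  have hd : ∀ l, HasFDerivAt (F l) (fderiv ℝ (F l) x₀) x₀ := fun l =>
    (((hF l).contDiffAt (hM.mem_nhds hx₀)).differentiableAt one_ne_zero).hasFDerivAt
  have hX : ∀ l x, horizontalField F k (Pi.single l 1) x =
      Pi.single l 1 - (F l x * (F k x)⁻¹) • Pi.single k 1 := by
    intro l x
    simp [horizontalField, Pi.single_apply, div_eq_mul_inv]
  set D : Fin n → (Fin n → ℝ) →L[ℝ] ℝ := fun l =>
    F l x₀ • (-(F k x₀ ^ 2)⁻¹ • fderiv ℝ (F k) x₀) + (F k x₀)⁻¹ • fderiv ℝ (F l) x₀ with hD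
  set L : Fin n → (Fin n → ℝ) →L[ℝ] (Fin n → ℝ) := fun l =>
    -(D l).smulRight (Pi.single k 1) with hLdef
  have hL : ∀ l, HasFDerivAt (horizontalField F k (Pi.single l 1)) (L l) x₀ := by
    intro l
    have h1 := (hd l).fun_mul ((hasDerivAt_inv hk₀).comp_hasFDerivAt x₀ (hd k))
    have h2 := (h1.smul_const (Pi.single k 1 : Fin n → ℝ)).const_sub (Pi.single l 1)
    rw [funext (hX l)]
    exact h2
  have hL' : ∀ l, HasFDerivAt (horizontalField F k (-Pi.single l 1)) (-L l) x₀ := by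
    intro l
    rw [horizontalField_neg]
    exact (hL l).neg
  obtain ⟨ψ₁, h₁⟩ := (HorizontalEndpoint.refl (F := F) (k := k) hx₀).append_flow hM hF hk hx₀ _
    (hL i)
  obtain ⟨ψ₂, h₂⟩ := h₁.append_flow hM hF hk hx₀ _ (hL j)
  obtain ⟨ψ₃, h₃⟩ := h₂.append_flow hM hF hk hx₀ _ (hL' i)
  obtain ⟨ψ, h⟩ := h₃.append_flow hM hF hk hx₀ _ (hL' j)
  simp only [horizontalField_neg, Pi.neg_apply] at h
  set Xi := horizontalField F k (Pi.single i 1) x₀ with hXi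
  set Xj := horizontalField F k (Pi.single j 1) x₀ with hXj
  have hv : 0 + Xi + Xj + -Xi + -Xj = 0 := by abel
  rw [hv] at h
  have hcoef : ∀ a, a = L j Xi - L i Xj → a k = -clairautR F i j k x₀ / F k x₀ ^ 2 := by
    rintro _ rfl
    rw [hXi, hXj, hX, hX]
    simp only [hLdef, hD, clairautR, pd, neg_apply,
      ContinuousLinearMap.smulRight_apply, add_apply,
      smul_apply, map_sub, map_smul, Pi.sub_apply, Pi.neg_apply,
      Pi.smul_apply, Pi.single_eq_same, smul_eq_mul]
    field_simp
    ring
  refine ⟨fun s => ψ s k - x₀ k, by simp [h.zero], ?_, ?_⟩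
  · filter_upwards [h.nearby] with s ⟨hc, hreach, hcoord⟩
    refine ⟨((continuous_apply k).continuousAt.comp hc).sub continuousAt_const, ?_⟩
    convert hreach using 1
    ext m
    by_cases hm : m = k
    · subst hm; simp
    · simp [hm, hcoord m hm]
  · have := (isLittleO_pi.mp h.expansion) k
    refine this.congr_left fun s => ?_
    simp only [Pi.sub_apply, Pi.smul_apply, smul_eq_mul, Pi.zero_apply, mul_zero, sub_zero]
    congr 2
    refine hcoef _ ?_
    simp only [map_add, map_neg, map_zero, neg_apply]
    module

end

/-- A continuous function behaving like `c s²` with `c > 0` takes all small nonnegative values. -/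
theorem exists_Icc_of_isLittleO_sq {e : ℝ → ℝ} {c : ℝ} (hc : 0 < c) (he : e 0 = 0) {P : ℝ → Prop}
    (hP : ∀ᶠ s in 𝓝 0, ContinuousAt e s ∧ P (e s))
    (hexp : (fun s => e s - s ^ 2 * c) =o[𝓝[>] 0] fun s : ℝ => s ^ 2) :
    ∃ η > 0, ∀ z ∈ Icc 0 η, P z := by
  obtain ⟨δ, hδ, hball⟩ := Metric.eventually_nhds_iff_ball.mp hP
  have hsmall : ∀ᶠ s : ℝ in 𝓝[>] 0, s < δ := nhdsWithin_le_nhds (Iio_mem_nhds hδ)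
  obtain ⟨s, hs, hsδ, hs0⟩ :=
    ((isLittleO_iff.mp hexp (half_pos hc)).and (hsmall.and self_mem_nhdsWithin)).exists
  replace hs0 : 0 < s := hs0
  have hmem : ∀ t ∈ Icc 0 s, t ∈ ball (0 : ℝ) δ := by
    intro t ht
    rw [Real.ball_eq_Ioo]
    exact ⟨by linarith [ht.1], by linarith [ht.2]⟩
  have hpos : 0 < e s := by
    rw [Real.norm_eq_abs, Real.norm_of_nonneg (sq_nonneg s)] at hs
    have := (abs_le.mp hs).1
    nlinarith [mul_pos hc (pow_pos hs0 2)]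
  refine ⟨e s, hpos, fun z hz => ?_⟩
  have hcont : ContinuousOn e (Icc 0 s) := fun t ht =>
    (hball t (hmem t ht)).1.continuousWithinAt
  obtain ⟨t, ht, rfl⟩ := intermediate_value_Icc hs0.le hcont (by rwa [he])
  exact (hball t (hmem t ht)).2

section

variable {n : ℕ} {F : Fin n → (Fin n → ℝ) → ℝ} {M : Set (Fin n → ℝ)} {k : Fin n}
  {x₀ : Fin n → ℝ}

theorem clairautR_swap (i j : Fin n) (x : Fin n → ℝ) :
    clairautR F j i k x = -clairautR F i j k x := by
  simp only [clairautR]; ring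

theorem clairautR_rotate (i j : Fin n) (x : Fin n → ℝ) :
    clairautR F j k i x = clairautR F i j k x := by
  simp only [clairautR]; ring

theorem exists_vertical_reachable (hM : IsOpen M) (hF : ∀ i, ContDiffOn ℝ 1 (F i) M)
    (hk : ∀ x ∈ M, F k x ≠ 0) (hx₀ : x₀ ∈ M) {i j : Fin n} (hR : clairautR F i j k x₀ ≠ 0) :
    ∀ᶠ z : ℝ in 𝓝 0, RestingNullReachable F M x₀ (x₀ + z • Pi.single k 1) := by
  wlog hneg : clairautR F i j k x₀ < 0 generalizing i j
  · have hsw := clairautR_swap (F := F) (k := k) i j x₀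
    exact this (i := j) (j := i) (by rw [hsw]; exact neg_ne_zero.mpr hR)
      (by rw [hsw]; exact neg_neg_of_pos (lt_of_le_of_ne (not_lt.mp hneg) hR.symm))
  have hc : 0 < -clairautR F i j k x₀ / F k x₀ ^ 2 :=
    div_pos (neg_pos.mpr hneg) (sq_pos_of_ne_zero (hk x₀ hx₀))
  obtain ⟨e, he, hP, hexp⟩ := exists_vertical_displacement hM hF hk hx₀ i j
  obtain ⟨η, hη, hup⟩ := exists_Icc_of_isLittleO_sq hc he (P := fun z =>
    RestingNullReachable F M x₀ (x₀ + z • Pi.single k 1)) hP hexp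
  obtain ⟨e', he', hP', hexp'⟩ := exists_vertical_displacement hM hF hk hx₀ j i
  obtain ⟨η', hη', hdown⟩ := exists_Icc_of_isLittleO_sq (e := fun s => -e' s) hc (by simp [he'])
    (P := fun z => RestingNullReachable F M x₀ (x₀ + (-z) • Pi.single k 1))
    (hP'.mono fun s hs => ⟨hs.1.neg, by simpa using hs.2⟩)
    (hexp'.neg_left.congr_left fun s => by rw [clairautR_swap (F := F) (k := k) i j]; ring)
  filter_upwards [Icc_mem_nhds (neg_lt_zero.mpr hη') hη] with z hz
  rcases le_total 0 z with h | h
  · exact hup z ⟨h, hz.2⟩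
  · simpa using hdown (-z) ⟨by linarith, by linarith [hz.1]⟩

/-- Points near `x₀` can be moved along null curves, staying near `x₀`, so as to agree with `x₀` in
any given coordinates other than the `k`-th one. -/
theorem eventually_exists_reachable_eqOn (hM : IsOpen M) (hF : ∀ i, ContDiffOn ℝ 1 (F i) M)
    (hk : ∀ x ∈ M, F k x ≠ 0) (hx₀ : x₀ ∈ M) (S : Finset (Fin n)) (hS : k ∉ S) :
    ∀ U ∈ 𝓝 x₀, ∀ᶠ x in 𝓝 x₀, ∃ x' ∈ U, RestingNullReachable F M x x' ∧
      ∀ m ∈ S, x' m = x₀ m := by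
  induction S using Finset.induction_on with
  | empty =>
    intro U hU
    filter_upwards [hU, hM.mem_nhds hx₀] with x hx hxM
    exact ⟨x, hx, .refl hxM, by simp⟩
  | insert l S hl ih =>
    intro U hU
    rw [Finset.mem_insert, not_or] at hS
    obtain ⟨φ, r, hr, hφ⟩ := exists_horizontal_flow hM hF hk hx₀ (Pi.single l 1)
    have hτ : ContinuousAt (fun x : Fin n → ℝ => x₀ l - x l) x₀ :=
      (continuous_const.sub (continuous_apply l)).continuousAt
    have hball : ∀ᶠ x in 𝓝 x₀, x₀ l - x l ∈ ball (0 : ℝ) r :=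
      hτ.eventually_mem (by simpa using ball_mem_nhds (0 : ℝ) hr)
    have hφc : ContinuousAt (fun x => φ (x, x₀ l - x l)) x₀ := by
      have h0 := ((hφ x₀ (mem_ball_self hr)).2 0 (mem_ball_self hr)).2.1
      exact ContinuousAt.comp₂ (f := φ) (by simpa using h0) continuousAt_id hτ
    have hφU : ∀ᶠ x in 𝓝 x₀, φ (x, x₀ l - x l) ∈ U :=
      hφc.eventually_mem (by simpa [(hφ x₀ (mem_ball_self hr)).1] using hU)
    refine (ih hS.2 _ (hφU.and (hball.and (ball_mem_nhds x₀ hr)))).mono ?_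
    rintro x ⟨x', ⟨hxU, hxb, hxr⟩, hreach, heq⟩
    obtain ⟨-, -, hreach', hcoord⟩ := (hφ x' hxr).2 _ hxb
    refine ⟨_, hxU, hreach.trans hreach', fun m hm => ?_⟩
    rcases Finset.mem_insert.mp hm with rfl | hmS
    · rw [hcoord m (Ne.symm hS.1)]; simp
    · have hmk : m ≠ k := fun h => hS.2 (h ▸ hmS)
      have hml : m ≠ l := fun h => hl (h ▸ hmS)
      rw [hcoord m hmk, heq m hmS]
      simp [hml]

theorem eventually_reachable (hM : IsOpen M) (hF : ∀ i, ContDiffOn ℝ 1 (F i) M)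
    (hk : ∀ x ∈ M, F k x ≠ 0) (hx₀ : x₀ ∈ M) {i j : Fin n} (hR : clairautR F i j k x₀ ≠ 0) :
    ∀ᶠ x in 𝓝 x₀, RestingNullReachable F M x₀ x := by
  have hU : ∀ᶠ y in 𝓝 x₀,
      RestingNullReachable F M x₀ (x₀ + (y k - x₀ k) • Pi.single k 1) := by
    have hc : Tendsto (fun y : Fin n → ℝ => y k - x₀ k) (𝓝 x₀) (𝓝 0) := by
      have : ContinuousAt (fun y : Fin n → ℝ => y k - x₀ k) x₀ :=
        ((continuous_apply k).sub continuous_const).continuousAt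
      simpa [ContinuousAt] using this
    exact hc.eventually (exists_vertical_reachable hM hF hk hx₀ hR)
  refine (eventually_exists_reachable_eqOn hM hF hk hx₀ (Finset.univ.erase k)
    (Finset.notMem_erase _ _) _ hU).mono ?_
  rintro x ⟨y, hy, hxy, heq⟩
  have hy' : x₀ + (y k - x₀ k) • Pi.single k 1 = y := by
    ext m
    by_cases hm : m = k
    · subst hm; simp
    · simp [hm, heq m (Finset.mem_erase.mpr ⟨hm, Finset.mem_univ m⟩)]
  change RestingNullReachable F M x₀ (x₀ + (y k - x₀ k) • Pi.single k 1) at hy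
  rw [hy'] at hy
  exact hy.trans hxy.symm

/-- Near a point where `F_k` and `R_{ijk}` do not vanish, all points of a suitable neighbourhood
are mutually reachable inside it. -/
theorem exists_isOpen_forall_nullReachable {B : Set (Fin n → ℝ)} (hB : IsOpen B)
    (hF : ∀ i, ContDiffOn ℝ (⊤ : ℕ∞) (F i) B) {x : Fin n → ℝ} (hx : x ∈ B) {i j : Fin n}
    (hk : F k x ≠ 0) (hR : clairautR F i j k x ≠ 0) :
    ∃ M ⊆ B, IsOpen M ∧ x ∈ M ∧ ∀ q ∈ M, NullReachable F M x q := by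
  have hFc : ∀ i, ContinuousAt (F i) x := fun i => (hF i).continuousOn.continuousAt (hB.mem_nhds hx)
  have hpd : ∀ i j, ContinuousAt (pd (F i) j) x := fun i j =>
    (((hF i).continuousOn_fderiv_of_isOpen hB (by simp)).continuousAt
      (hB.mem_nhds hx)).clm_apply continuousAt_const
  have hRc : ContinuousAt (clairautR F i j k) x :=
    (((hFc i).mul ((hpd k j).sub (hpd j k))).add ((hFc j).mul ((hpd i k).sub (hpd k i)))).add
      ((hFc k).mul ((hpd j i).sub (hpd i j)))
  obtain ⟨r, hr, hball⟩ := Metric.eventually_nhds_iff_ball.mp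
    ((hB.eventually_mem hx).and (((hFc k).eventually_ne hk).and (hRc.eventually_ne hR)))
  refine ⟨ball x r, fun y hy => (hball y hy).1, isOpen_ball, mem_ball_self hr, fun q hq => ?_⟩
  refine RestingNullReachable.nullReachable ?_
  refine (convex_ball x r).isPreconnected.induction₂ (RestingNullReachable F (ball x r))
    (fun y hy => ?_) (fun _ _ _ _ _ _ h h' => h.trans h') (fun _ _ _ _ h => h.symm)
    (mem_ball_self hr) hq
  exact nhdsWithin_le_nhds (eventually_reachable isOpen_ball
    (fun l => ((hF l).mono fun z hz => (hball z hz).1).of_le (by simp))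
    (fun z hz => (hball z hz).2.1) hy (hball y hy).2.2)

end

/-- (Key step in the converse of Carathéodory's theorem) If near every point `p` of the
open set `B ⊆ ℝⁿ`, every open neighborhood `M ⊆ B` of `p` contains a point unreachable
from `p` along null curves of the Pfaffian form contained in `M`, then the Clairaut
quantity `R_{ijk}` vanishes identically on `B`. -/
theorem caratheodory_converse_key_step
    (n : ℕ) (B : Set (Fin n → ℝ)) (hB : IsOpen B)
    (F : Fin n → (Fin n → ℝ) → ℝ)
    (hF : ∀ i, ContDiffOn ℝ (⊤ : ℕ∞) (F i) B)
    (hF0 : ∀ x ∈ B, (fun i => F i x) ≠ 0)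
    (hunreach : ∀ p ∈ B, ∀ M : Set (Fin n → ℝ), M ⊆ B → IsOpen M → p ∈ M →
      ∃ q ∈ M, ¬ NullReachable F M p q) :
    ∀ i j k, ∀ x ∈ B, clairautR F i j k x = 0 := by
  have key : ∀ i j k, ∀ x ∈ B, F k x ≠ 0 → clairautR F i j k x = 0 := by
    intro i j k x hx hk
    by_contra hR
    obtain ⟨M, hMB, hM, hxM, hreach⟩ := exists_isOpen_forall_nullReachable hB hF hx hk hR
    obtain ⟨q, hq, hnot⟩ := hunreach x hx M hMB hM hxM
    exact hnot (hreach q hq)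
  intro i j k x hx
  by_cases hk : F k x = 0
  · by_cases hi : F i x = 0
    · by_cases hj : F j x = 0
      · simp [clairautR, hi, hj, hk]
      · rw [← clairautR_rotate, ← clairautR_rotate]
        exact key k i j x hx hj
    · rw [← clairautR_rotate]
      exact key j k i x hx hi
  · exact key i j k x hx hk
end
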